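/- arXiv:2604.06615 — 3 statements merged into one kernel-verified Lean document; each statement's English description precedes it below -/
import Mathlib

section
/- Let f = Σ_μ c_μ s_μ be a homogeneous symmetric polynomial of degree d in n variables such that there exists a partition λ with c_λ ≠ 0 and c_μ ≠ 0 only if μ ⊴ λ. Then the Newton polytope of f equals the λ-permutahedron P_λ. Moreover, if additionally all c_μ ≥ 0, then f has a saturated Newton polytope. -/
open Finset

/-- `mu` is dominated by `lam`: every partial sum of `mu` is at most that of `lam`. -/
def Dominated (mu lam : ℕ → ℕ) : Prop :=
  ∀ k : ℕ, ∑ i ∈ Finset.range k, mu i ≤ ∑ i ∈ Finset.range k, lam i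

/-- The number of cells of the tableau `T` whose entry equals `v`. -/
def contentCount {μ : YoungDiagram} (T : SemistandardYoungTableau μ) (v : ℕ) : ℕ :=
  (μ.cells.filter fun c => T c.1 c.2 = v).card

/-- The Kostka number `K_{lam,mu}`: the number of semistandard Young tableaux of shape
`lam` and content `mu` (entries `0`-based). -/
noncomputable def kostka (lam : YoungDiagram) (mu : ℕ → ℕ) : ℕ :=
  Set.ncard {T : SemistandardYoungTableau lam | ∀ v : ℕ, contentCount T v = mu v}

/-- The Schur polynomial `s_lam(x_1, …, x_n)`, via its monomial expansion
`s_lam = ∑_α K_{lam,α} x^α` over all exponent vectors `α` of total degree `|lam|`. -/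
noncomputable def schur (lam : YoungDiagram) (n : ℕ) : MvPolynomial (Fin n) ℝ :=
  ∑ α ∈ Finset.Nat.antidiagonalTuple n lam.card,
    (kostka lam (fun v => if h : v < n then α ⟨v, h⟩ else 0) : ℝ) •
      ∏ i, MvPolynomial.X i ^ α i

/-- The permutahedron `P_lam ⊆ ℝ^n`. -/
noncomputable def permutahedron (n : ℕ) (lam : ℕ → ℕ) : Set (Fin n → ℝ) :=
  convexHull ℝ {v | ∃ σ : Equiv.Perm (Fin n), v = fun i => (lam (σ i : ℕ) : ℝ)}

/-- The Newton polytope of a polynomial: the convex hull of its exponent vectors. -/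
noncomputable def newtonPolytope {n : ℕ} (f : MvPolynomial (Fin n) ℝ) : Set (Fin n → ℝ) :=
  convexHull ℝ {v | ∃ α ∈ f.support, v = fun i => ((α i : ℕ) : ℝ)}

/-- `f` has a saturated Newton polytope: the lattice points of `Newton(f)` are
exactly the exponent vectors in the support of `f`. -/
def SNP {n : ℕ} (f : MvPolynomial (Fin n) ℝ) : Prop :=
  ∀ α : Fin n → ℕ,
    ((fun i => (α i : ℝ)) ∈ newtonPolytope f ↔ ∃ β ∈ f.support, ∀ i, β i = α i)

lemma sum_le_of_anti (g : ℕ → ℕ) (hg : Antitone g) (B : Finset ℕ) :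
    ∑ i ∈ B, g i ≤ ∑ i ∈ Finset.range B.card, g i := by
  induction B using Finset.induction_on_max with
  | empty => simp
  | insert m s hm ih =>
    have hms : m ∉ s := fun h => lt_irrefl _ (hm m h)
    rw [Finset.sum_insert hms, Finset.card_insert_of_notMem hms, Finset.sum_range_succ, add_comm]
    refine add_le_add ih (hg ?_)
    have : s ⊆ Finset.range m := fun x hx => Finset.mem_range.2 (hm x hx)
    simpa using Finset.card_le_card this

lemma card_filter_row (μ : YoungDiagram) (k : ℕ) :
    (μ.cells.filter (fun c => c.1 < k)).card = ∑ i ∈ Finset.range k, μ.rowLen i := by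
  rw [Finset.card_eq_sum_card_fiberwise (f := Prod.fst) (t := Finset.range k)]
  · refine Finset.sum_congr rfl fun i hi => ?_
    rw [YoungDiagram.rowLen_eq_card]
    congr 1
    ext c
    simp only [Finset.mem_filter, YoungDiagram.mem_row_iff, YoungDiagram.mem_cells]
    rw [Finset.mem_range] at hi
    constructor
    · rintro ⟨⟨h, _⟩, h2⟩; exact ⟨h, h2⟩
    · rintro ⟨h, h2⟩; exact ⟨⟨h, h2 ▸ hi⟩, h2⟩
  · intro c hc
    simp only [Finset.coe_filter, Set.mem_ofPred_eq] at hc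
    simpa using hc.2

lemma card_eq_sum_row (μ : YoungDiagram) (n : ℕ) (h : ∀ i, n ≤ i → μ.rowLen i = 0) :
    μ.card = ∑ i ∈ Finset.range n, μ.rowLen i := by
  rw [← card_filter_row, Finset.filter_true_of_mem]
  rintro ⟨i, j⟩ hc
  rw [YoungDiagram.mem_cells, YoungDiagram.mem_iff_lt_rowLen] at hc
  by_contra hi
  rw [h i (not_lt.1 hi)] at hc
  omega

lemma ssyt_nec {μ : YoungDiagram} (T : SemistandardYoungTableau μ) (A : Finset ℕ) :
    ∑ v ∈ A, contentCount T v ≤ ∑ i ∈ Finset.range A.card, μ.rowLen i := by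
  have h1 : ∑ v ∈ A, contentCount T v = (μ.cells.filter (fun c => T c.1 c.2 ∈ A)).card := by
    rw [Finset.card_eq_sum_card_fiberwise (f := fun c : ℕ × ℕ => T c.1 c.2) (t := A)]
    · refine Finset.sum_congr rfl fun v hv => ?_
      unfold contentCount
      congr 1
      ext c
      simp only [Finset.mem_filter]
      constructor
      · rintro ⟨h, h2⟩; exact ⟨⟨h, h2 ▸ hv⟩, h2⟩
      · rintro ⟨⟨h, _⟩, h2⟩; exact ⟨h, h2⟩
    · intro c hc
      simp only [Finset.coe_filter, Set.mem_ofPred_eq] at hc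
      exact hc.2
  have key : ∀ p : ℕ × ℕ → Prop, [DecidablePred p] → (μ.cells.filter p).card =
      ∑ j ∈ μ.cells.image Prod.snd, ((μ.cells.filter p).filter (fun c => c.2 = j)).card := by
    intro p _
    refine Finset.card_eq_sum_card_fiberwise (f := Prod.snd) ?_
    intro c hc
    simp only [Finset.coe_filter, Set.mem_ofPred_eq] at hc
    exact Finset.mem_coe.2 (Finset.mem_image_of_mem _ hc.1)
  rw [h1, ← card_filter_row, key, key]
  refine Finset.sum_le_sum fun j _ => ?_
  have hle : ((μ.cells.filter (fun c => T c.1 c.2 ∈ A)).filter (fun c => c.2 = j)).card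
      ≤ min A.card (μ.colLen j) := by
    refine le_min ?_ ?_
    · refine Finset.card_le_card_of_injOn (fun c => T c.1 c.2) ?_ ?_
      · intro c hc
        simp only [Finset.coe_filter, Finset.mem_filter, Set.mem_ofPred_eq] at hc
        exact hc.1.2
      · rintro ⟨i1, j1⟩ hc ⟨i2, j2⟩ hc' h
        simp only [Finset.coe_filter, Finset.mem_filter, Set.mem_ofPred_eq,
          YoungDiagram.mem_cells] at hc hc' h
        obtain ⟨⟨m1, _⟩, rfl⟩ := hc
        obtain ⟨⟨m2, _⟩, rfl⟩ := hc'
        rcases lt_trichotomy i1 i2 with hl | hl | hl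
        · exact absurd h (T.col_strict hl m2).ne
        · rw [hl]
        · exact absurd h (T.col_strict hl m1).ne'
    · rw [YoungDiagram.colLen_eq_card]
      refine Finset.card_le_card fun c hc => ?_
      simp only [Finset.mem_filter, YoungDiagram.mem_cells] at hc
      exact YoungDiagram.mem_col_iff.2 ⟨hc.1.1, hc.2⟩
  refine hle.trans ?_
  rw [← Finset.card_range (min A.card (μ.colLen j))]
  refine Finset.card_le_card_of_injOn (fun i => (i, j)) ?_ ?_
  · intro i hi
    simp only [Finset.coe_range, Set.mem_Iio, lt_min_iff] at hi
    simp only [Finset.coe_filter, Finset.mem_filter, Set.mem_ofPred_eq,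
          YoungDiagram.mem_cells]
    exact ⟨⟨YoungDiagram.mem_iff_lt_colLen.2 hi.2, hi.1⟩, trivial⟩
  · intro a _ b _ h
    exact (Prod.mk.inj h).1

lemma ssyt_exists (n : ℕ) : ∀ (μ : YoungDiagram) (α : ℕ → ℕ),
    (∀ i, n ≤ i → μ.rowLen i = 0) → (∀ v, n ≤ v → α v = 0) →
    (∑ v ∈ Finset.range n, α v = μ.card) →
    (∀ A ⊆ Finset.range n, ∑ v ∈ A, α v ≤ ∑ i ∈ Finset.range A.card, μ.rowLen i) →
    ∃ T : SemistandardYoungTableau μ, ∀ v, contentCount T v = α v := by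
  induction n with
  | zero =>
    intro μ α hμ hα hs hA
    refine ⟨SemistandardYoungTableau.highestWeight μ, fun v => ?_⟩
    rw [hα v (Nat.zero_le _)]
    have : μ.cells = ∅ := by
      rw [← Finset.card_eq_zero]
      simpa using hs.symm
    simp [contentCount, this]
  | succ n ih =>
    intro μ α hμ hα hs hA
    obtain ⟨a, ha⟩ : ∃ a, a = α n := ⟨_, rfl⟩
    have ha0 : a ≤ μ.rowLen 0 := by
      have := hA {n} (by simp)
      simpa [← ha] using this
    have hcard := card_eq_sum_row μ (n+1) hμ
    have han : μ.rowLen n ≤ a := by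
      have := hA (Finset.range n) (by simp)
      rw [Finset.card_range] at this
      rw [Finset.sum_range_succ] at hs hcard
      omega
    obtain ⟨l, hl⟩ : ∃ l : ℕ → ℕ, ∀ i, l i = (μ.rowLen i - a) + min a (μ.rowLen (i+1)) :=
      ⟨_, fun _ => rfl⟩
    have hanti := μ.rowLen_anti
    have hl1 : ∀ i, l i ≤ μ.rowLen i := by
      intro i; have := hanti i (i+1) (by omega); rw [hl]; omega
    have hl2 : ∀ i, μ.rowLen (i+1) ≤ l i := by
      intro i; have := hanti i (i+1) (by omega); rw [hl]; omega
    have hlanti : ∀ i i', i ≤ i' → l i' ≤ l i := by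
      intro i i' h
      have h1 := hanti i i' h
      have h2 := hanti (i+1) (i'+1) (by omega)
      rw [hl, hl]; omega
    let ν : YoungDiagram :=
      { cells := μ.cells.filter (fun c => c.2 < l c.1)
        isLowerSet := by
          rintro ⟨i, j⟩ ⟨i', j'⟩ hle hm
          obtain ⟨h1, h2⟩ := Prod.mk_le_mk.1 hle
          simp only [Finset.coe_filter, Set.mem_ofPred_eq, YoungDiagram.mem_cells] at hm ⊢
          have := hlanti _ _ h1
          exact ⟨μ.up_left_mem h1 h2 hm.1, by omega⟩ }
    have hνmem : ∀ i j, (i, j) ∈ ν ↔ j < l i := by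
      intro i j
      rw [← YoungDiagram.mem_cells]
      simp only [ν, Finset.mem_filter, YoungDiagram.mem_cells, YoungDiagram.mem_iff_lt_rowLen]
      have := hl1 i
      omega
    have hνrow : ∀ i, ν.rowLen i = l i := by
      intro i
      have h : ∀ j, j < ν.rowLen i ↔ j < l i := fun j => by
        rw [← YoungDiagram.mem_iff_lt_rowLen, hνmem]
      have h1 := h (l i)
      have h2 := h (ν.rowLen i)
      omega
    have hνμ : ∀ i j, (i, j) ∈ ν → (i, j) ∈ μ := by
      intro i j h
      rw [hνmem] at h
      rw [YoungDiagram.mem_iff_lt_rowLen]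
      exact h.trans_le (hl1 i)
    have hpart : ∀ k, ∑ i ∈ Finset.range k, ν.rowLen i + a =
        ∑ i ∈ Finset.range k, μ.rowLen i + min a (μ.rowLen k) := by
      intro k
      induction k with
      | zero => simp; omega
      | succ k ihk =>
        rw [Finset.sum_range_succ, Finset.sum_range_succ, hνrow, hl]
        omega
    have hνlen : ∀ i, n ≤ i → ν.rowLen i = 0 := by
      intro i hi
      have h1 := hμ (i+1) (by omega)
      have h2 := hanti n i hi
      rw [hνrow, hl]
      omega
    have hνcard : ν.card + a = μ.card := by
      rw [card_eq_sum_row ν n hνlen, hcard, hpart, Finset.sum_range_succ]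
      omega
    obtain ⟨T, hT⟩ := ih ν (Function.update α n 0) hνlen
      (by
        intro v hv
        rcases eq_or_lt_of_le hv with h | h
        · simp [← h]
        · rw [Function.update_of_ne (by omega)]; exact hα v h)
      (by
        rw [Finset.sum_range_succ, ← hνcard, ← ha] at hs
        have : ∑ v ∈ Finset.range n, Function.update α n 0 v = ∑ v ∈ Finset.range n, α v := by
          refine Finset.sum_congr rfl fun v hv => ?_
          rw [Function.update_of_ne]
          rw [Finset.mem_range] at hv; omega
        omega)
      (by
        intro A hAn
        have hnA : n ∉ A := fun h => by simpa using hAn h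
        have e : ∑ v ∈ A, Function.update α n 0 v = ∑ v ∈ A, α v := by
          refine Finset.sum_congr rfl fun v hv => ?_
          rw [Function.update_of_ne]
          rintro rfl; exact hnA hv
        rw [e]
        have hsub : Finset.range n ⊆ Finset.range (n+1) := by
          intro x; simp only [Finset.mem_range]; omega
        have h1 := hA A (hAn.trans hsub)
        have h2 := hA (insert n A) (Finset.insert_subset (by simp) (hAn.trans hsub))
        rw [Finset.sum_insert hnA, Finset.card_insert_of_notMem hnA, Finset.sum_range_succ,
          ← ha] at h2
        have h3 := hpart A.card
        omega)
    have hTlt : ∀ i j, (i, j) ∈ ν → T i j < n := by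
      intro i j h
      by_contra hn
      have h0 : contentCount T (T i j) = 0 := by
        rw [hT]
        rcases eq_or_lt_of_le (not_lt.1 hn) with h | h
        · simp [← h]
        · rw [Function.update_of_ne (by omega)]; exact hα _ h
      unfold contentCount at h0
      rw [Finset.card_eq_zero] at h0
      have : (i, j) ∈ ν.cells.filter (fun c => T c.1 c.2 = T i j) := by
        simp [h]
      rw [h0] at this
      simp at this
    let T' : SemistandardYoungTableau μ :=
      { entry := fun i j => if (i, j) ∈ ν then T i j else if (i, j) ∈ μ then n else 0
        row_weak' := by
          intro i j1 j2 hj hm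
          by_cases h2 : (i, j2) ∈ ν
          · have h1 : (i, j1) ∈ ν := ν.up_left_mem le_rfl hj.le h2
            rw [if_pos h1, if_pos h2]
            exact T.row_weak hj h2
          · rw [if_neg h2, if_pos hm]
            by_cases h1 : (i, j1) ∈ ν
            · rw [if_pos h1]; exact (hTlt _ _ h1).le
            · rw [if_neg h1]; split_ifs <;> omega
        col_strict' := by
          intro i1 i2 j hi hm
          have h1 : (i1, j) ∈ ν := by
            rw [hνmem]
            rw [YoungDiagram.mem_iff_lt_rowLen] at hm
            have := hl2 i1
            have := hanti (i1+1) i2 hi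
            omega
          rw [if_pos h1]
          by_cases h2 : (i2, j) ∈ ν
          · rw [if_pos h2]; exact T.col_strict hi h2
          · rw [if_neg h2, if_pos hm]; exact hTlt _ _ h1
        zeros' := by
          intro i j h
          rw [if_neg (fun h' => h (hνμ _ _ h')), if_neg h] }
    have hT' : ∀ i j, T' i j = if (i, j) ∈ ν then T i j else if (i, j) ∈ μ then n else 0 :=
      fun _ _ => rfl
    refine ⟨T', fun v => ?_⟩
    by_cases hv : v = n
    · subst hv
      have : μ.cells.filter (fun c => T' c.1 c.2 = v) = μ.cells \ ν.cells := by
        ext ⟨i, j⟩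
        simp only [Finset.mem_filter, Finset.mem_sdiff, YoungDiagram.mem_cells]
        refine and_congr_right fun hm => ?_
        rw [hT']
        by_cases h : (i, j) ∈ ν
        · have := hTlt _ _ h
          simp only [h, if_true, not_true, iff_false]; omega
        · simp [h, hm]
      unfold contentCount
      rw [this, Finset.card_sdiff_of_subset (fun ⟨i, j⟩ h => hνμ i j h)]
      change μ.card - ν.card = _
      omega
    · have h1 := hT v
      rw [Function.update_of_ne hv] at h1
      rw [← h1]
      unfold contentCount
      congr 1
      ext ⟨i, j⟩
      simp only [Finset.mem_filter, YoungDiagram.mem_cells]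
      rw [hT']
      by_cases h : (i, j) ∈ ν
      · simp [h, hνμ _ _ h]
      · simp only [h, if_false, false_and, iff_false]
        rintro ⟨hm, h2⟩
        rw [if_pos hm] at h2
        exact hv h2.symm

/-- extension of a finite tuple by zero -/
def extz {n : ℕ} (α : Fin n → ℕ) : ℕ → ℕ := fun v => if h : v < n then α ⟨v, h⟩ else 0

lemma extz_val {n : ℕ} (α : Fin n → ℕ) (i : Fin n) : extz α i = α i := by
  simp [extz]

lemma extz_ge {n : ℕ} (α : Fin n → ℕ) (v : ℕ) (h : n ≤ v) : extz α v = 0 := by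
  simp [extz, not_lt.2 h]

lemma kostka_ne_zero {n : ℕ} (μ : YoungDiagram) (α : Fin n → ℕ) :
    kostka μ (extz α) ≠ 0 ↔
      ∃ T : SemistandardYoungTableau μ, ∀ v, contentCount T v = extz α v := by
  have hfin : {T : SemistandardYoungTableau μ | ∀ v : ℕ, contentCount T v = extz α v}.Finite := by
    have hf : (Set.univ.pi (fun _ : μ.cells => Set.Iio n)).Finite :=
      Set.Finite.pi fun _ => Set.finite_Iio n
    refine Set.Finite.of_finite_image (f := fun T (c : μ.cells) => T c.1.1 c.1.2)
      (hf.subset ?_) ?_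
    · rintro _ ⟨T, hT, rfl⟩ ⟨⟨i, j⟩, hc⟩ _
      by_contra hn
      simp only [Set.mem_Iio, not_lt] at hn
      have h0 : contentCount T (T i j) = 0 := by
        rw [hT, extz_ge _ _ hn]
      unfold contentCount at h0
      rw [Finset.card_eq_zero] at h0
      have : (i, j) ∈ μ.cells.filter (fun c => T c.1 c.2 = T i j) :=
        Finset.mem_filter.2 ⟨hc, rfl⟩
      rw [h0] at this
      simp at this
    · intro T _ T' _ h
      ext i j
      by_cases hc : (i, j) ∈ μ
      · exact congrFun h ⟨(i, j), (YoungDiagram.mem_cells _).2 hc⟩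
      · rw [T.zeros hc, T'.zeros hc]
  unfold kostka
  rw [Ne, Set.ncard_eq_zero hfin, ← Ne, ← Set.nonempty_iff_ne_empty]
  rfl

lemma kostka_nec {n : ℕ} (μ : YoungDiagram) (α : Fin n → ℕ) (h : kostka μ (extz α) ≠ 0)
    (A : Finset (Fin n)) : ∑ i ∈ A, α i ≤ ∑ i ∈ Finset.range A.card, μ.rowLen i := by
  obtain ⟨T, hT⟩ := (kostka_ne_zero μ α).1 h
  have := ssyt_nec T (A.map Fin.valEmbedding)
  rw [Finset.sum_map, Finset.card_map] at this
  simpa [hT, extz_val] using this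

lemma kostka_suff {n : ℕ} (μ : YoungDiagram) (α : Fin n → ℕ)
    (hμ : ∀ i, n ≤ i → μ.rowLen i = 0) (hs : ∑ i, α i = μ.card)
    (hA : ∀ A : Finset (Fin n), ∑ i ∈ A, α i ≤ ∑ i ∈ Finset.range A.card, μ.rowLen i) :
    kostka μ (extz α) ≠ 0 := by
  rw [kostka_ne_zero]
  refine ssyt_exists n μ (extz α) hμ (extz_ge α) ?_ ?_
  · rw [Finset.sum_range, ← hs]
    simp [extz_val]
  · intro A hAn
    have e : A = (Finset.univ.filter (fun i : Fin n => (i : ℕ) ∈ A)).map Fin.valEmbedding := by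
      ext x
      simp only [Finset.mem_map, Finset.mem_filter, Finset.mem_univ, true_and,
        Fin.valEmbedding_apply]
      constructor
      · intro hx
        exact ⟨⟨x, Finset.mem_range.1 (hAn hx)⟩, hx, rfl⟩
      · rintro ⟨y, hy, rfl⟩; exact hy
    rw [e, Finset.sum_map, Finset.card_map]
    simpa [extz_val] using hA _

lemma coeff_schur {n : ℕ} (μ : YoungDiagram) (α : Fin n →₀ ℕ) :
    MvPolynomial.coeff α (schur μ n) =
      if ∑ i, α i = μ.card then (kostka μ (extz α) : ℝ) else 0 := by
  unfold schur
  rw [MvPolynomial.coeff_sum]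
  have h : ∀ β : Fin n → ℕ, MvPolynomial.coeff α
      ((kostka μ (fun v => if h : v < n then β ⟨v, h⟩ else 0) : ℝ) •
        (∏ i, MvPolynomial.X i ^ β i : MvPolynomial (Fin n) ℝ)) =
      if β = α then (kostka μ (extz α) : ℝ) else 0 := by
    intro β
    have e : (∏ i, MvPolynomial.X i ^ β i : MvPolynomial (Fin n) ℝ) =
        MvPolynomial.monomial (Finsupp.equivFunOnFinite.symm β) 1 := by
      rw [MvPolynomial.monomial_eq, Finsupp.prod_fintype]
      · simp
      · simp
    rw [e, MvPolynomial.coeff_smul, MvPolynomial.coeff_monomial]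
    by_cases hb : β = α
    · subst hb
      simp
      rfl
    · rw [if_neg, if_neg hb, smul_zero]
      rintro rfl
      exact hb rfl
  rw [Finset.sum_congr rfl fun β _ => h β, Finset.sum_ite_eq']
  simp [Finset.Nat.mem_antidiagonalTuple]

lemma abel_aux (g z : ℕ → ℝ) (m : ℕ) (hg : ∀ i, i < m → g i ≤ g (i+1))
    (hz : ∀ k, k ≤ m → 0 ≤ ∑ i ∈ Finset.range k, z i) :
    ∑ i ∈ Finset.range (m+1), g i * z i ≤ g m * ∑ i ∈ Finset.range (m+1), z i := by
  induction m with
  | zero => simp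
  | succ m ih =>
    rw [Finset.sum_range_succ _ (m+1), Finset.sum_range_succ z (m+1)]
    have h1 := ih (fun i hi => hg i (by omega)) (fun k hk => hz k (by omega))
    have h2 := mul_le_mul_of_nonneg_right (hg m (by omega)) (hz (m+1) le_rfl)
    linarith

lemma rado (n : ℕ) (l : ℕ → ℕ) (x : Fin n → ℝ)
    (hA : ∀ A : Finset (Fin n), ∑ i ∈ A, x i ≤ ∑ i ∈ Finset.range A.card, (l i : ℝ))
    (hs : ∑ i, x i = ∑ i ∈ Finset.range n, (l i : ℝ)) :
    x ∈ permutahedron n l := by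
  by_contra hx
  have hfin : {v : Fin n → ℝ | ∃ σ : Equiv.Perm (Fin n), v = fun i => (l (σ i : ℕ) : ℝ)}.Finite := by
    refine (Set.finite_range
      (fun σ : Equiv.Perm (Fin n) => fun i => (l (σ i : ℕ) : ℝ))).subset ?_
    rintro _ ⟨σ, rfl⟩
    exact ⟨σ, rfl⟩
  obtain ⟨f, u, hfu, hfb⟩ := geometric_hahn_banach_point_closed (convex_convexHull ℝ _)
    (hfin.isClosed_convexHull ℝ) hx
  obtain ⟨w, hw⟩ : ∃ w : Fin n → ℝ, ∀ y : Fin n → ℝ, f y = ∑ i, w i * y i := by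
    refine ⟨fun i => f (Pi.single i 1), fun y => ?_⟩
    conv_lhs => rw [pi_eq_sum_univ' y]
    rw [map_sum]
    refine Finset.sum_congr rfl fun i _ => ?_
    rw [map_smul, smul_eq_mul, mul_comm]
  let ρ := Tuple.sort w
  have hρ : Monotone (w ∘ ρ) := Tuple.monotone_sort w
  have hb := hfb _ (subset_convexHull ℝ _ ⟨ρ.symm, rfl⟩)
  have hlt := hfu.trans hb
  rw [hw, hw, ← Equiv.sum_comp ρ, ← Equiv.sum_comp ρ (fun i => w i * (l (ρ.symm i : ℕ) : ℝ))] at hlt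
  simp only [Equiv.symm_apply_apply] at hlt
  rcases n with _ | m
  · simp at hlt
  let g : ℕ → ℝ := fun i => if h : i < m+1 then w (ρ ⟨i, h⟩) else 0
  let z : ℕ → ℝ := fun i => (l i : ℝ) - if h : i < m+1 then x (ρ ⟨i, h⟩) else 0
  have hpart : ∀ k, k ≤ m+1 → 0 ≤ ∑ i ∈ Finset.range k, z i := by
    intro k hk
    have h := hA ((Finset.univ : Finset (Fin k)).map ((Fin.castLEEmb hk).trans ρ.toEmbedding))
    rw [Finset.sum_map, Finset.card_map, Finset.card_univ, Fintype.card_fin] at h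
    have e : ∑ i ∈ Finset.range k, (if h : i < m+1 then x (ρ ⟨i, h⟩) else 0) =
        ∑ i : Fin k, x (((Fin.castLEEmb hk).trans ρ.toEmbedding) i) := by
      rw [Finset.sum_range]
      refine Finset.sum_congr rfl fun i _ => ?_
      rw [dif_pos (by omega)]
      rfl
    simp only [z, Finset.sum_sub_distrib, e]
    linarith
  have htot : ∑ i ∈ Finset.range (m+1), z i = 0 := by
    simp only [z, Finset.sum_sub_distrib]
    rw [← hs, Finset.sum_range (fun i => if h : i < m+1 then x (ρ ⟨i, h⟩) else 0),
      ← Equiv.sum_comp ρ, sub_eq_zero]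
    refine Finset.sum_congr rfl fun i _ => ?_
    rw [dif_pos i.2]
  have hab := abel_aux g z m
    (by
      intro i hi
      simp only [g]
      rw [dif_pos (by omega), dif_pos (by omega)]
      exact hρ (Fin.mk_le_mk.2 (by omega)))
    (fun k hk => hpart k (by omega))
  rw [htot, mul_zero, Finset.sum_range] at hab
  have e2 : ∑ i : Fin (m+1), g i * z i =
      ∑ i, w (ρ i) * (l (i : ℕ) : ℝ) - ∑ i, w (ρ i) * x (ρ i) := by
    rw [← Finset.sum_sub_distrib]
    refine Finset.sum_congr rfl fun i _ => ?_
    simp only [g, z, i.2, dif_pos, Fin.eta]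
    ring
  linarith

lemma perm_maj (n : ℕ) (l : ℕ → ℕ) (hl : Antitone l) (σ : Equiv.Perm (Fin n))
    (A : Finset (Fin n)) :
    ∑ i ∈ A, l (σ i : ℕ) ≤ ∑ i ∈ Finset.range A.card, l i := by
  have := sum_le_of_anti l hl (A.map (σ.toEmbedding.trans Fin.valEmbedding))
  rw [Finset.sum_map, Finset.card_map] at this
  simpa using this

lemma perm_tot (n : ℕ) (l : ℕ → ℕ) (σ : Equiv.Perm (Fin n)) :
    ∑ i, l (σ i : ℕ) = ∑ i ∈ Finset.range n, l i := by
  rw [Equiv.sum_comp σ (fun i : Fin n => l i), Finset.sum_range]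

lemma permutahedron_maj (n : ℕ) (l : ℕ → ℕ) (hl : Antitone l) (x : Fin n → ℝ)
    (hx : x ∈ permutahedron n l) :
    (∀ A : Finset (Fin n), ∑ i ∈ A, x i ≤ ∑ i ∈ Finset.range A.card, (l i : ℝ)) ∧
    ∑ i, x i = ∑ i ∈ Finset.range n, (l i : ℝ) := by
  have hlin : ∀ A : Finset (Fin n), IsLinearMap ℝ (fun x : Fin n → ℝ => ∑ i ∈ A, x i) := fun A =>
    ⟨fun x y => by simp [Finset.sum_add_distrib], fun c x => by simp [Finset.mul_sum]⟩
  constructor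
  · intro A
    refine convexHull_min (t := {x | ∑ i ∈ A, x i ≤ ∑ i ∈ Finset.range A.card, (l i : ℝ)}) ?_
      (convex_halfSpace_le (hlin A) _) hx
    rintro _ ⟨σ, rfl⟩
    have := perm_maj n l hl σ A
    change ∑ i ∈ A, (l (σ i : ℕ) : ℝ) ≤ _
    exact_mod_cast this
  · refine convexHull_min (t := {x | ∑ i, x i = ∑ i ∈ Finset.range n, (l i : ℝ)}) ?_
      (convex_hyperplane (hlin Finset.univ) _) hx
    rintro _ ⟨σ, rfl⟩
    have := perm_tot n l σ
    change ∑ i, (l (σ i : ℕ) : ℝ) = _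
    exact_mod_cast this

lemma diag_ext (μ ν : YoungDiagram) (h : ∀ i, μ.rowLen i = ν.rowLen i) : μ = ν := by
  ext ⟨i, j⟩
  rw [YoungDiagram.mem_cells, YoungDiagram.mem_cells, YoungDiagram.mem_iff_lt_rowLen,
    YoungDiagram.mem_iff_lt_rowLen, h]

/-- Monical–Tokcan–Yong: if `f = ∑_μ c_μ s_μ` is a homogeneous symmetric
polynomial of degree `d` in `n` variables with `c_lam ≠ 0` and `c_μ ≠ 0` only for `μ ⊴ lam`,
then `Newton(f) = P_lam`; if moreover all `c_μ ≥ 0` then `f` is SNP. -/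
theorem stmt3 (n d : ℕ) (S : Finset YoungDiagram) (hS : ∀ μ ∈ S, μ.card = d)
    (c : YoungDiagram → ℝ) (lam : YoungDiagram) (hlamS : lam ∈ S) (hclam : c lam ≠ 0)
    (hlen : ∀ i, n ≤ i → lam.rowLen i = 0)
    (hdom : ∀ μ ∈ S, c μ ≠ 0 → Dominated μ.rowLen lam.rowLen) :
    newtonPolytope (∑ μ ∈ S, c μ • schur μ n) = permutahedron n lam.rowLen ∧
      ((∀ μ, 0 ≤ c μ) → SNP (∑ μ ∈ S, c μ • schur μ n)) := by
  have hanti : Antitone lam.rowLen := fun i j h => lam.rowLen_anti i j h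
  have hlamd : ∑ i ∈ Finset.range n, lam.rowLen i = d := by
    rw [← card_eq_sum_row lam n hlen, hS lam hlamS]
  have hcoeff : ∀ α : Fin n →₀ ℕ, MvPolynomial.coeff α (∑ μ ∈ S, c μ • schur μ n) =
      if ∑ i, α i = d then ∑ μ ∈ S, c μ * (kostka μ (extz α) : ℝ) else 0 := by
    intro α
    rw [MvPolynomial.coeff_sum]
    split_ifs with h
    · refine Finset.sum_congr rfl fun μ hμ => ?_
      rw [MvPolynomial.coeff_smul, coeff_schur, hS μ hμ, if_pos h, smul_eq_mul]
    · refine Finset.sum_eq_zero fun μ hμ => ?_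
      rw [MvPolynomial.coeff_smul, coeff_schur, hS μ hμ, if_neg h, smul_zero]
  have hN : newtonPolytope (∑ μ ∈ S, c μ • schur μ n) = permutahedron n lam.rowLen := by
    apply Set.Subset.antisymm
    · refine convexHull_min ?_ (convex_convexHull ℝ _)
      rintro _ ⟨α, hα, rfl⟩
      rw [MvPolynomial.mem_support_iff, hcoeff] at hα
      split_ifs at hα with hd
      · obtain ⟨μ, hμ, hne⟩ := Finset.exists_ne_zero_of_sum_ne_zero hα
        have hc : c μ ≠ 0 := left_ne_zero_of_mul hne
        have hk : kostka μ (extz α) ≠ 0 := by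
          exact_mod_cast right_ne_zero_of_mul hne
        refine rado n lam.rowLen _ (fun A => ?_) ?_
        · have := (kostka_nec μ α hk A).trans (hdom μ hμ hc _)
          exact_mod_cast this
        · rw [← hlamd] at hd
          exact_mod_cast hd
      · exact absurd rfl hα
    · refine convexHull_min ?_ (convex_convexHull ℝ _)
      rintro _ ⟨σ, rfl⟩
      refine subset_convexHull ℝ _
        ⟨Finsupp.equivFunOnFinite.symm (fun i => lam.rowLen (σ i : ℕ)), ?_, rfl⟩
      have htot : ∑ i, lam.rowLen (σ i : ℕ) = d := (perm_tot n lam.rowLen σ).trans hlamd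
      rw [MvPolynomial.mem_support_iff, hcoeff, if_pos (by simpa using htot)]
      rw [Finset.sum_eq_single lam]
      · refine mul_ne_zero hclam ?_
        have := kostka_suff lam (fun i => lam.rowLen (σ i : ℕ)) hlen
          (htot.trans (hS lam hlamS).symm) (perm_maj n lam.rowLen hanti σ)
        exact_mod_cast this
      · intro μ hμ hne
        by_contra h0
        have hc : c μ ≠ 0 := left_ne_zero_of_mul h0
        have hk : kostka μ (extz (fun i => lam.rowLen (σ i : ℕ))) ≠ 0 := by
          exact_mod_cast right_ne_zero_of_mul h0
        have hle : ∀ k, k ≤ n → ∑ i ∈ Finset.range k, lam.rowLen i ≤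
            ∑ i ∈ Finset.range k, μ.rowLen i := by
          intro k hkn
          have := kostka_nec μ _ hk
            ((Finset.univ : Finset (Fin k)).map ((Fin.castLEEmb hkn).trans σ.symm.toEmbedding))
          rw [Finset.sum_map, Finset.card_map, Finset.card_univ, Fintype.card_fin] at this
          rw [Finset.sum_range]
          simpa using this
        have heq : ∀ k, ∑ i ∈ Finset.range k, lam.rowLen i =
            ∑ i ∈ Finset.range k, μ.rowLen i := by
          intro k
          refine le_antisymm ?_ (hdom μ hμ hc k)
          rcases le_total k n with h | h
          · exact hle k h
          · have h1 : ∑ i ∈ Finset.range k, lam.rowLen i = d := by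
              rw [← card_eq_sum_row lam k (fun i hi => hlen i (h.trans hi)), hS lam hlamS]
            rw [h1, ← hlamd]
            refine (hle n le_rfl).trans ?_
            exact Finset.sum_le_sum_of_subset (Finset.range_mono h)
        apply hne
        apply diag_ext
        intro i
        have h1 := heq i
        have h2 := heq (i+1)
        rw [Finset.sum_range_succ, Finset.sum_range_succ] at h2
        omega
      · intro h; exact absurd hlamS h
  refine ⟨hN, fun hc0 α => ⟨fun hα => ?_, ?_⟩⟩
  · rw [hN] at hα
    obtain ⟨hA, hs⟩ := permutahedron_maj n lam.rowLen hanti _ hα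
    have hA' : ∀ A : Finset (Fin n), ∑ i ∈ A, α i ≤
        ∑ i ∈ Finset.range A.card, lam.rowLen i := fun A => by exact_mod_cast hA A
    have hs' : ∑ i, α i = d := by
      rw [← hlamd]; exact_mod_cast hs
    refine ⟨Finsupp.equivFunOnFinite.symm α, ?_, fun _ => rfl⟩
    rw [MvPolynomial.mem_support_iff, hcoeff, if_pos (by simpa using hs')]
    have hk : kostka lam (extz α) ≠ 0 :=
      kostka_suff lam α hlen (hs'.trans (hS lam hlamS).symm) hA'
    apply ne_of_gt
    refine Finset.sum_pos' (fun μ _ => mul_nonneg (hc0 μ) (Nat.cast_nonneg _)) ⟨lam, hlamS, ?_⟩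
    refine mul_pos (lt_of_le_of_ne (hc0 lam) hclam.symm) ?_
    exact_mod_cast Nat.pos_of_ne_zero hk
  · rintro ⟨β, hβ, he⟩
    refine subset_convexHull ℝ _ ⟨β, hβ, ?_⟩
    funext i
    rw [he i]
end

section
/- The multiplicity of the trivial representation of the Young subgroup S_μ in the restriction to S_μ of the irreducible representation of S_d indexed by the partition λ equals the Kostka number K_{λ,μ}. -/
open Finset

/-- `lam` is a partition of `d`: weakly decreasing, eventually zero, summing to `d`. -/
def IsPartitionOf (d : ℕ) (lam : ℕ → ℕ) : Prop :=
  Antitone lam ∧ ∃ N : ℕ, (∀ i, N ≤ i → lam i = 0) ∧ ∑ i ∈ Finset.range N, lam i = d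

open scoped Classical in
/-- The permutation character `ξ^mu` of `S_d`: `ξ^mu(g)` is the number of functions
`f : [d] → ℕ` constant on the cycles of `g` whose fiber over `k` has size `mu k`
(this is the character of the action of `S_d` on ordered set partitions of `[d]`
with block sizes `mu`, i.e. the character with Frobenius characteristic `h_mu`);
it is `0` when some entry of `mu` is negative. -/
noncomputable def permChar (d : ℕ) (mu : ℕ → ℤ) (g : Equiv.Perm (Fin d)) : ℤ :=
  if ∀ k, 0 ≤ mu k then
    (Set.ncard {f : Fin d → ℕ | (∀ i, f (g i) = f i) ∧
        ∀ k : ℕ, (((Finset.univ.filter fun i => f i = k)).card : ℤ) = mu k} : ℤ)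
  else 0

/-- The irreducible character `χ^lam` of the symmetric group `S_d` indexed by the
partition `lam` (with at most `n` parts, `0`-indexed), defined by the
Jacobi–Trudi determinantal formula `χ^lam = ∑_w sgn(w) ξ^{(lam i - i + w i)_i}`. -/
noncomputable def irredChar (d n : ℕ) (lam : Fin n → ℕ) (g : Equiv.Perm (Fin d)) : ℤ :=
  ∑ w : Equiv.Perm (Fin n), (Equiv.Perm.sign w : ℤ) *
    permChar d
      (fun k => if h : k < n then
          (lam ⟨k, h⟩ : ℤ) + ((w ⟨k, h⟩ : ℕ) : ℤ) - (k : ℤ)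
        else 0) g

/-- The index of the block of the Young subgroup `S_mu` containing `i`
(the number of partial sums of `mu` that are `≤ i`). -/
def youngBlock (mu : ℕ → ℕ) (i : ℕ) : ℕ :=
  ((Finset.range (i + 1)).filter fun k => ∑ j ∈ Finset.range (k + 1), mu j ≤ i).card

open scoped Classical in
/-- The Young subgroup `S_mu ⊆ S_d` (as a finset): permutations preserving each
consecutive block of sizes `mu 0, mu 1, …`. -/
noncomputable def youngMembers (d : ℕ) (mu : ℕ → ℕ) : Finset (Equiv.Perm (Fin d)) :=
  Finset.univ.filter fun σ => ∀ i : Fin d, youngBlock mu (σ i : ℕ) = youngBlock mu (i : ℕ)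


namespace KP
set_option linter.unusedSectionVars false

lemma exists_perm {X A : Type*} [Fintype X] [DecidableEq X] [DecidableEq A] (F G : X → A)
    (h : ∀ a, #{x | F x = a} = #{x | G x = a}) :
    ∃ p : Equiv.Perm X, ∀ x, F (p x) = G x := by
  have e : ∀ a, Nonempty ({x // G x = a} ≃ {x // F x = a}) := by
    intro a
    refine ⟨Fintype.equivOfCardEq ?_⟩
    rw [Fintype.card_subtype, Fintype.card_subtype, h a]
  replace e := fun a => (e a).some
  refine ⟨(Equiv.sigmaFiberEquiv G).symm.trans
    ((Equiv.sigmaCongrRight e).trans (Equiv.sigmaFiberEquiv F)), ?_⟩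
  intro x
  simp [Equiv.sigmaFiberEquiv]
  exact (e (G x) ⟨x, rfl⟩).2

section burn
variable {X K I : Type*} [Fintype X] [DecidableEq X] [Fintype K] [DecidableEq K]
  [Fintype I] [DecidableEq I]

def mat (blk : X → K) (f : X → I) (k : K) (i : I) : ℕ := #{x | blk x = k ∧ f x = i}

def Y (blk : X → K) : Finset (Equiv.Perm X) := {g | ∀ x, blk (g x) = blk x}

lemma mem_Y (blk : X → K) (g) : g ∈ Y blk ↔ ∀ x, blk (g x) = blk x := by simp [Y]

lemma mat_comp (blk : X → K) (f : X → I) (g) (hg : g ∈ Y blk) :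
    mat blk (fun x => f (g x)) = mat blk f := by
  rw [mem_Y] at hg
  funext k i
  unfold mat
  refine Finset.card_bij (fun x _ => g x) ?_ ?_ ?_
  · simp [hg]
  · simp
  · intro b hb
    refine ⟨g.symm b, ?_, by simp⟩
    have := hg (g.symm b)
    simp at this hb ⊢
    rw [← this]; exact hb

lemma exists_Y (blk : X → K) (f f' : X → I) (h : mat blk f = mat blk f') :
    ∃ g ∈ Y blk, ∀ x, f (g x) = f' x := by
  obtain ⟨p, hp⟩ := exists_perm (fun x => (blk x, f x)) (fun x => (blk x, f' x)) (by
    rintro ⟨k, i⟩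
    have := congrFun (congrFun h k) i
    simpa [mat] using this)
  simp at hp
  exact ⟨p, (mem_Y _ _).2 fun x => (hp x).1, fun x => (hp x).2⟩

lemma orbit_sum (blk : X → K) (f0 : X → I) :
    ∑ f : X → I with mat blk f = mat blk f0, #{g ∈ Y blk | ∀ x, f (g x) = f x} = #(Y blk) := by
  rw [Finset.card_eq_sum_card_fiberwise (f := fun g : Equiv.Perm X => fun x => f0 (g x))
    (t := ({f : X → I | mat blk f = mat blk f0} : Finset _))]
  · refine Finset.sum_congr rfl fun f hf => ?_
    simp at hf
    obtain ⟨h, hY, hh⟩ := exists_Y blk f0 f hf.symm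
    rw [mem_Y] at hY
    refine Finset.card_bij (fun g _ => h * g) ?_ ?_ ?_
    · intro g hg
      simp [mem_Y] at hg ⊢
      refine ⟨fun x => by rw [hY, hg.1], ?_⟩
      funext x
      rw [hh, hg.2]
    · simp
    · intro g hg
      simp [mem_Y] at hg
      refine ⟨h⁻¹ * g, ?_, by simp⟩
      simp [mem_Y]
      refine ⟨fun x => ?_, fun x => ?_⟩
      · rw [← hY]; simp [hg.1]
      · rw [← hh]; simp; exact congrFun hg.2 x
  · intro g hg
    simp
    exact mat_comp _ _ _ hg

lemma exists_mat (blk : X → K) (m : K → I → ℕ) (h : ∀ k, ∑ i, m k i = #{x | blk x = k}) :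
    ∃ f : X → I, mat blk f = m := by
  have e : ∀ k, Nonempty ({x // blk x = k} ≃ (Σ i, Fin (m k i))) := by
    intro k
    refine ⟨Fintype.equivOfCardEq ?_⟩
    rw [Fintype.card_subtype, ← h]; simp
  replace e := fun a => (e a).some
  refine ⟨fun x => (e (blk x) ⟨x, rfl⟩).1, ?_⟩
  funext k i
  unfold mat
  rw [← Fintype.card_fin (m k i), ← Fintype.card_subtype]
  have h1 : ∀ x (hx : blk x = k), (e (blk x) ⟨x, rfl⟩).1 = (e k ⟨x, hx⟩).1 := by
    rintro x rfl; rfl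
  symm
  refine Fintype.card_of_bijective (f := fun t : Fin (m k i) =>
    (⟨((e k).symm ⟨i, t⟩).1, ((e k).symm ⟨i, t⟩).2, by
      rw [h1 _ ((e k).symm ⟨i, t⟩).2]; simp⟩ : {x // blk x = k ∧ (e (blk x) ⟨x, rfl⟩).1 = i})) ?_
  constructor
  · intro s t hst
    simp at hst
    have := (e k).symm.injective (Subtype.ext hst)
    simpa using this
  · rintro ⟨x, hx, hi⟩
    replace hi := (h1 x hx).symm.trans hi
    subst hi
    refine ⟨(e k ⟨x, hx⟩).2, ?_⟩
    simp

lemma row_mat (blk : X → K) (f : X → I) (k : K) : ∑ i, mat blk f k i = #{x | blk x = k} := by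
  rw [Finset.card_eq_sum_card_fiberwise (f := f) (t := univ) (by simp)]
  refine Finset.sum_congr rfl fun i _ => ?_
  rw [Finset.filter_filter]; rfl

lemma col_mat (blk : X → K) (f : X → I) (i : I) : ∑ k, mat blk f k i = #{x | f x = i} := by
  rw [Finset.card_eq_sum_card_fiberwise (f := blk) (t := univ) (by simp)]
  refine Finset.sum_congr rfl fun k _ => ?_
  rw [Finset.filter_filter]; simp only [mat, and_comm]

def mats (μ : K → ℕ) (α : I → ℤ) : Finset (K → I → ℕ) :=
  {m ∈ Fintype.piFinset (fun k => piAntidiag univ (μ k)) | ∀ i, (∑ k, (m k i : ℤ)) = α i}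

lemma burnside (blk : X → K) (μ : K → ℕ) (hμ : ∀ k, #{x | blk x = k} = μ k) (α : I → ℤ) :
    ∑ g ∈ Y blk, #{f : X → I | (∀ x, f (g x) = f x) ∧ ∀ i, (#{x | f x = i} : ℤ) = α i} =
      #(Y blk) * #(mats μ α) := by
  have h1 : ∀ g ∈ Y blk, #{f : X → I | (∀ x, f (g x) = f x) ∧ ∀ i, (#{x | f x = i} : ℤ) = α i}
     = ∑ m ∈ mats μ α, ∑ f : X → I with mat blk f = m, if ∀ x, f (g x) = f x then 1 else 0 := by
    intro g hg
    rw [Finset.card_eq_sum_card_fiberwise (f := mat blk) (t := mats μ α)]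
    · refine Finset.sum_congr rfl fun m hm => ?_
      rw [← Finset.sum_filter, Finset.filter_filter, Finset.filter_filter, Finset.card_eq_sum_ones]
      refine Finset.sum_congr ?_ fun _ _ => rfl
      ext f
      simp
      constructor
      · tauto
      · rintro ⟨rfl, h2⟩
        refine ⟨⟨h2, fun i => ?_⟩, rfl⟩
        simp [mats] at hm
        rw [← hm.2, ← col_mat blk]; simp
    · intro f hf
      simp at hf
      simp [mats, row_mat, hμ]
      intro i
      rw [← hf.2, ← col_mat blk]; simp
  rw [Finset.sum_congr rfl h1, Finset.sum_comm, mul_comm, ← smul_eq_mul, ← Finset.sum_const]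
  refine Finset.sum_congr rfl fun m hm => ?_
  rw [Finset.sum_comm]
  obtain ⟨f0, rfl⟩ := exists_mat blk m (by
    intro k
    simp [mats] at hm
    rw [hm.1, hμ])
  rw [← orbit_sum blk f0]
  refine Finset.sum_congr rfl fun f hf => ?_
  simp
end burn

/-- matrix count -/
def M (μ : ℕ → ℕ) {n : ℕ} (N : ℕ) (α : Fin n → ℤ) : ℤ := #(mats (K := Fin N) (fun k => μ k) α)

lemma M_zero (μ : ℕ → ℕ) {n : ℕ} (α : Fin n → ℤ) : M μ 0 α = if α = 0 then 1 else 0 := by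
  unfold M mats
  simp [Finset.filter_const, funext_iff, eq_comm]
  split_ifs <;> simp

lemma M_succ (μ : ℕ → ℕ) {n : ℕ} (N : ℕ) (α : Fin n → ℤ) :
    M μ (N+1) α = ∑ c ∈ piAntidiag univ (μ N), M μ N (fun i => α i - (c i : ℤ)) := by
  unfold M
  rw [Finset.card_eq_sum_card_fiberwise (f := fun m => m (Fin.last N)) (t := piAntidiag univ (μ N))]
  · push_cast
    refine Finset.sum_congr rfl fun c hc => ?_
    norm_cast
    refine Finset.card_bij' (fun m _ => Fin.init m) (fun m _ => Fin.snoc (α := fun _ => Fin n → ℕ) m c) ?_ ?_ ?_ ?_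
    · intro m hm
      simp [mats, Fin.init, Fin.sum_univ_castSucc] at hm ⊢
      obtain ⟨⟨h1, h2⟩, rfl⟩ := hm
      refine ⟨fun a => by simpa using h1 a.castSucc, fun i => ?_⟩
      rw [← h2]; simp
    · intro m hm
      simp [mats, Fin.sum_univ_castSucc] at hm hc ⊢
      refine ⟨fun a => ?_, fun i => ?_⟩
      · refine Fin.lastCases ?_ (fun a => ?_) a
        · simpa using hc
        · simpa using hm.1 a
      · rw [hm.2]; simp
    · intro m hm
      simp at hm
      rw [← hm.2]
      exact Fin.snoc_init_self m
    · intro m hm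
      simp
  · intro m hm
    simp [mats] at hm ⊢
    simpa using hm.1 (Fin.last N)


lemma M_neg (μ : ℕ → ℕ) {n : ℕ} (N : ℕ) (α : Fin n → ℤ) (i) (hi : α i < 0) : M μ N α = 0 := by
  unfold M
  simp only [Nat.cast_eq_zero, card_eq_zero]
  rw [Finset.eq_empty_iff_forall_notMem]
  intro m hm
  simp only [mats, mem_filter] at hm
  have := hm.2 i
  have : 0 ≤ ∑ k, (m k i : ℤ) := Finset.sum_nonneg fun _ _ => by positivity
  omega

lemma perm_mem {n : ℕ} (σ : Equiv.Perm (Fin n)) (c : Fin n → ℕ) (t : ℕ)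
    (hc : c ∈ piAntidiag univ t) : (fun i => c (σ i)) ∈ piAntidiag univ t := by
  simp at hc ⊢
  rw [← hc]
  exact Equiv.sum_comp σ c

lemma M_perm (μ : ℕ → ℕ) {n : ℕ} (N : ℕ) (σ : Equiv.Perm (Fin n)) : ∀ (α : Fin n → ℤ),
    M μ N (fun i => α (σ i)) = M μ N α := by
  induction N with
  | zero =>
    intro α
    rw [M_zero, M_zero]
    congr 1
    simp [funext_iff]
    exact ⟨fun h i => by simpa using h (σ.symm i), fun h i => h _⟩
  | succ N ih =>
    intro α
    rw [M_succ, M_succ]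
    refine Finset.sum_bij' (fun c _ i => c (σ.symm i)) (fun c _ i => c (σ i)) ?_ ?_ ?_ ?_ ?_
    · intro c hc; exact perm_mem _ _ _ hc
    · intro c hc; exact perm_mem _ _ _ hc
    · intro c hc; simp
    · intro c hc; simp
    · intro c hc
      rw [← ih (fun i => α i - ((c (σ.symm i) : ℕ) : ℤ))]
      simp

def D (μ : ℕ → ℕ) {n : ℕ} (N : ℕ) (a : Fin n → ℤ) : ℤ :=
  ∑ w : Equiv.Perm (Fin n), (Equiv.Perm.sign w : ℤ) * M μ N (fun i => a i + ((w i : ℕ) : ℤ))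

lemma D_perm (μ : ℕ → ℕ) {n : ℕ} (N : ℕ) (σ : Equiv.Perm (Fin n)) (a : Fin n → ℤ) :
    D μ N (fun i => a (σ i)) = Equiv.Perm.sign σ * D μ N a := by
  unfold D
  rw [Finset.mul_sum]
  rw [← Equiv.sum_comp (Equiv.mulRight σ)]
  refine Finset.sum_congr rfl fun w _ => ?_
  have := M_perm μ N σ (fun i => a i + ((w i : ℕ) : ℤ))
  simp at this ⊢
  rw [this]; ring

lemma D_succ (μ : ℕ → ℕ) {n : ℕ} (N : ℕ) (a : Fin n → ℤ) :
    D μ (N+1) a = ∑ c ∈ piAntidiag univ (μ N), D μ N (fun i => a i - (c i : ℤ)) := by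
  unfold D
  rw [Finset.sum_comm]
  refine Finset.sum_congr rfl fun w _ => ?_
  rw [M_succ, Finset.mul_sum]
  refine Finset.sum_congr rfl fun c _ => ?_
  congr 2
  funext i; ring

lemma D_neg (μ : ℕ → ℕ) {n : ℕ} (N : ℕ) (a : Fin n → ℤ) (i) (hi : a i + n ≤ 0) :
    D μ N a = 0 := by
  unfold D
  refine Finset.sum_eq_zero fun w _ => ?_
  rw [M_neg μ N _ i, mul_zero]
  have := (w i).2
  omega

lemma D_zero (μ : ℕ → ℕ) {n : ℕ} (l : Fin n → ℕ) :
    D μ 0 (fun i => (l i : ℤ) - ((i : ℕ) : ℤ)) = if l = 0 then 1 else 0 := by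
  unfold D
  rw [Finset.sum_eq_single 1]
  · rw [M_zero]
    simp [funext_iff]
  · intro w _ hw
    rw [M_zero, if_neg, mul_zero]
    intro h
    apply hw
    have h1 : ∀ i, w i ≤ i := by
      intro i
      have := congrFun h i
      simp at this
      rw [Fin.le_def]; omega
    have h2 : ∑ i, ((w i : ℕ)) = ∑ i : Fin n, (i : ℕ) := Equiv.sum_comp w (fun i => (i : ℕ))
    have h3 := (Finset.sum_eq_sum_iff_of_le (fun i _ => Fin.le_def.1 (h1 i))).1 h2
    ext i
    simpa using h3 i (mem_univ _)
  · simp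

/-- partial goodness -/
def good {n : ℕ} (l : Fin n → ℕ) (c : Fin n → ℕ) (k : ℕ) : Prop :=
  ∀ i j : Fin n, (i : ℕ) < k → (j : ℕ) = i + 1 → l j + c i ≤ l i

open scoped Classical in
lemma D_cancel (μ : ℕ → ℕ) {n : ℕ} (N t : ℕ) (l : Fin n → ℕ) (hl : Antitone l) (k : ℕ) :
    ∑ c ∈ piAntidiag univ t, D μ N (fun i => (l i : ℤ) - ((i : ℕ) : ℤ) - (c i : ℤ)) =
    ∑ c ∈ piAntidiag univ t with good l c k,
      D μ N (fun i => (l i : ℤ) - ((i : ℕ) : ℤ) - (c i : ℤ)) := by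
  induction k with
  | zero =>
    rw [Finset.filter_true_of_mem]
    intro c _ i j h; omega
  | succ k ih =>
    rw [ih, ← Finset.sum_filter_add_sum_filter_not (s := filter _ _) (fun c => good l c (k+1)),
      Finset.filter_filter, Finset.filter_filter]
    have e1 : ∀ c : Fin n → ℕ, (good l c k ∧ good l c (k+1)) ↔ good l c (k+1) := by
      intro c
      refine ⟨fun h => h.2, fun h => ⟨fun i j hi hj => h i j (by omega) hj, h⟩⟩
    simp only [e1]
    rw [add_eq_left]
    by_cases hk : k + 1 < n
    swap
    · apply Finset.sum_eq_zero
      intro c hc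
      exfalso
      simp only [mem_filter] at hc
      apply hc.2.2
      intro i j hi hj
      have := j.2
      exact hc.2.1 i j (by omega) hj
    set p : Fin n := ⟨k, by omega⟩ with hp
    set q : Fin n := ⟨k+1, hk⟩ with hq
    have hpq : p ≠ q := by simp [hp, hq]
    have e2 : ∀ c : Fin n → ℕ, (good l c k ∧ ¬ good l c (k+1)) ↔ (good l c k ∧ l p < l q + c p) := by
      intro c
      refine and_congr_right fun h => ?_
      rw [← not_le, not_iff_not]
      constructor
      · intro h'; exact h' p q (by simp [hp]) (by simp [hp, hq])
      · intro h' i j hi hj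
        by_cases hik : (i : ℕ) = k
        · have : i = p := Fin.ext hik
          have : j = q := Fin.ext (by simp [hq]; omega)
          subst i j; exact h'
        · exact h i j (by omega) hj
    simp only [e2]
    -- the swapped vector: new c
    have key : ∀ S : ℤ, S = -S → S = 0 := fun S h => by omega
    apply key
    rw [← Finset.sum_neg_distrib]
    have hlpq : l q ≤ l p := hl (by rw [Fin.le_def]; simp [hp, hq])
    set s : Equiv.Perm (Fin n) := Equiv.swap p q with hs
    set T : (Fin n → ℕ) → (Fin n → ℕ) := fun c i =>
      ((l i : ℤ) - ((i : ℕ) : ℤ) - ((l (s i) : ℤ) - ((s i : ℕ) : ℤ) - (c (s i) : ℤ))).toNat with hT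
    have hTe : ∀ c, l p < l q + c p → ∀ i, (T c i : ℤ) =
        (l i : ℤ) - ((i : ℕ) : ℤ) - ((l (s i) : ℤ) - ((s i : ℕ) : ℤ) - (c (s i) : ℤ)) := by
      intro c hc i
      simp only [hT]
      apply Int.toNat_of_nonneg
      by_cases hip : i = p
      · subst hip
        have h2 : s p = q := Equiv.swap_apply_left _ _
        rw [h2]
        have : (q : ℕ) = p + 1 := by simp [hp, hq]
        omega
      · by_cases hiq : i = q
        · subst hiq
          have h2 : s q = p := Equiv.swap_apply_right _ _
          rw [h2]
          have : (q : ℕ) = p + 1 := by simp [hp, hq]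
          omega
        · have h2 : s i = i := Equiv.swap_apply_of_ne_of_ne hip hiq
          rw [h2]
          omega
    have hss : ∀ i, s (s i) = i := fun i => by simp [hs]
    have hTp : ∀ c, l p < l q + c p → l p < l q + T c p := by
      intro c hc
      have := hTe c hc p
      have h2 : s p = q := Equiv.swap_apply_left _ _
      rw [h2] at this
      have : (q : ℕ) = p + 1 := by simp [hp, hq]
      omega
    have hTT : ∀ c, l p < l q + c p → T (T c) = c := by
      intro c hc
      funext i
      have h1 := hTe (T c) (hTp c hc) i
      have h2 := hTe c hc (s i)
      rw [hss] at h2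
      omega
    have hmem : ∀ c ∈ ({c ∈ piAntidiag univ t | good l c k ∧ l p < l q + c p} : Finset (Fin n → ℕ)),
        T c ∈ ({c ∈ piAntidiag univ t | good l c k ∧ l p < l q + c p} : Finset (Fin n → ℕ)) := by
      intro c hc
      simp only [mem_filter] at hc ⊢
      obtain ⟨hc1, hc2, hc3⟩ := hc
      refine ⟨?_, ?_, hTp c hc3⟩
      · simp at hc1 ⊢
        zify at hc1 ⊢
        rw [← hc1, Finset.sum_congr rfl fun i _ => hTe c hc3 i, Finset.sum_sub_distrib,
          Equiv.sum_comp s (fun i => (l i : ℤ) - ((i : ℕ) : ℤ) - (c i : ℤ)),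
          ← Finset.sum_sub_distrib]
        refine Finset.sum_congr rfl fun i _ => by ring
      · intro i j hi hj
        have h2 : s i = i := Equiv.swap_apply_of_ne_of_ne
          (fun h => by rw [h, hp] at hi; simp at hi) (fun h => by rw [h, hq] at hi; simp at hi)
        have := hTe c hc3 i
        rw [h2] at this
        have := hc2 i j hi hj
        omega
    refine Finset.sum_bij' (fun c _ => T c) (fun c _ => T c) hmem hmem ?_ ?_ ?_
    · intro c hc; exact hTT c (mem_filter.1 hc).2.2
    · intro c hc; exact hTT c (mem_filter.1 hc).2.2
    · intro c hc
      have h1 := D_perm μ N s (fun i => (l i : ℤ) - ((i : ℕ) : ℤ) - (c i : ℤ))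
      rw [Equiv.Perm.sign_swap hpq] at h1
      have h3 : (fun i => (l i : ℤ) - ((i : ℕ) : ℤ) - (T c i : ℤ)) =
          fun i => (l (s i) : ℤ) - ((s i : ℕ) : ℤ) - (c (s i) : ℤ) := by
        funext i
        rw [hTe c (mem_filter.1 hc).2.2 i]; ring
      rw [h3, h1]; simp

/-- the horizontal strips -/
def strips {n : ℕ} (l : Fin n → ℕ) (t : ℕ) : Finset (Fin n → ℕ) :=
  {c ∈ piAntidiag univ t | (∀ i, c i ≤ l i) ∧ ∀ i j : Fin n, (j : ℕ) = i + 1 → l j + c i ≤ l i}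

lemma D_rec (μ : ℕ → ℕ) {n : ℕ} (N : ℕ) (l : Fin n → ℕ) (hl : Antitone l) :
    D μ (N+1) (fun i => (l i : ℤ) - ((i : ℕ) : ℤ)) =
    ∑ c ∈ strips l (μ N), D μ N (fun i => ((l i - c i : ℕ) : ℤ) - ((i : ℕ) : ℤ)) := by
  classical
  rw [D_succ, D_cancel μ N _ l hl n]
  have : ∀ c ∈ strips l (μ N), D μ N (fun i => ((l i - c i : ℕ) : ℤ) - ((i : ℕ) : ℤ)) =
      D μ N (fun i => (l i : ℤ) - ((i : ℕ) : ℤ) - (c i : ℤ)) := by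
    intro c hc
    simp only [strips, mem_filter] at hc
    congr 1
    funext i
    have := hc.2.1 i
    omega
  rw [Finset.sum_congr rfl this]
  symm
  refine Finset.sum_subset ?_ ?_
  · intro c hc
    simp only [strips, mem_filter] at hc ⊢
    exact ⟨hc.1, fun i j _ hj => hc.2.2 i j hj⟩
  · intro c hc hc'
    simp only [strips, mem_filter] at hc hc'
    have h1 : ∀ i j : Fin n, (j : ℕ) = i + 1 → l j + c i ≤ l i := fun i j hj => hc.2 i j i.2 hj
    have h2 : ¬ ∀ i, c i ≤ l i := fun h => hc' ⟨hc.1, h, h1⟩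
    push Not at h2
    obtain ⟨i, hi⟩ := h2
    apply D_neg μ N _ i
    by_cases hin : (i : ℕ) + 1 < n
    · have := h1 i ⟨i + 1, hin⟩ rfl
      omega
    · omega

structure P (μ : ℕ → ℕ) {n : ℕ} (N : ℕ) (l : Fin n → ℕ) (T : Fin n → ℕ → ℕ) : Prop where
  z : ∀ i j, l i ≤ j → T i j = 0
  lt : ∀ i j, j < l i → T i j < N
  row : ∀ i j₁ j₂, j₁ < j₂ → j₂ < l i → T i j₁ ≤ T i j₂
  col : ∀ i₁ i₂ j, i₁ < i₂ → j < l i₂ → T i₁ j < T i₂ j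
  cont : ∀ v < N, ∑ i, #{j ∈ range (l i) | T i j = v} = μ v

def extn (N : ℕ) {n : ℕ} (l c : Fin n → ℕ) (T : Fin n → ℕ → ℕ) : Fin n → ℕ → ℕ :=
  fun i j => if j < l i - c i then T i j else if j < l i then N else 0

open scoped Classical in
noncomputable def SST (μ : ℕ → ℕ) {n : ℕ} : ℕ → (Fin n → ℕ) → Finset (Fin n → ℕ → ℕ)
  | 0, l => if l = 0 then {0} else ∅
  | N+1, l => (strips l (μ N)).biUnion fun c => (SST μ N (fun i => l i - c i)).image (extn N l c)

lemma strips_le {n : ℕ} {l : Fin n → ℕ} (hl : Antitone l) {t : ℕ} {c : Fin n → ℕ}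
    (hc : c ∈ strips l t) (i j : Fin n) (hij : i < j) : l j + c i ≤ l i := by
  simp only [strips, mem_filter] at hc
  rw [Fin.lt_def] at hij
  have h1 := hc.2.2 i ⟨i + 1, by omega⟩ rfl
  have h2 : l j ≤ l ⟨i+1, by omega⟩ := hl (by rw [Fin.le_def]; simpa using hij)
  omega

lemma strips_anti {n : ℕ} {l : Fin n → ℕ} (hl : Antitone l) {t : ℕ} {c : Fin n → ℕ}
    (hc : c ∈ strips l t) : Antitone (fun i => l i - c i) := by
  intro i j hij
  rcases hij.eq_or_lt with rfl | h
  · rfl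
  · have := strips_le hl hc i j h
    show l j - c j ≤ l i - c i
    omega

lemma ext_count {n : ℕ} (N : ℕ) {l c : Fin n → ℕ} (hc : ∀ i, c i ≤ l i) (T : Fin n → ℕ → ℕ)
    (hT : ∀ i j, j < l i - c i → T i j < N) (i : Fin n) :
    #{j ∈ range (l i) | extn N l c T i j = N} = c i := by
  have : ({j ∈ range (l i) | extn N l c T i j = N} : Finset ℕ) = Finset.Ico (l i - c i) (l i) := by
    ext j
    simp only [mem_filter, mem_range, mem_Ico]
    simp only [extn]
    have := hT i j
    split_ifs <;> omega
  rw [this, Nat.card_Ico]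
  have := hc i
  omega

lemma ext_count_lt {n : ℕ} (N : ℕ) {l c : Fin n → ℕ} (T : Fin n → ℕ → ℕ)
    (v : ℕ) (hv : v < N) (i : Fin n) :
    #{j ∈ range (l i) | extn N l c T i j = v} = #{j ∈ range (l i - c i) | T i j = v} := by
  congr 1
  ext j
  simp only [mem_filter, mem_range]
  simp only [extn]
  split_ifs <;> omega

lemma P_ext (μ : ℕ → ℕ) {n : ℕ} (N : ℕ) {l c : Fin n → ℕ} (hl : Antitone l)
    (hc : c ∈ strips l (μ N)) (T : Fin n → ℕ → ℕ) (hT : P μ N (fun i => l i - c i) T) :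
    P μ (N+1) l (extn N l c T) := by
  have hc' := hc
  simp only [strips, mem_filter] at hc'
  constructor
  · intro i j h
    simp only [extn]
    rw [if_neg (by omega), if_neg (by omega)]
  · intro i j h
    have := hT.lt i j
    simp only [extn]
    split_ifs <;> omega
  · intro i j₁ j₂ h1 h2
    have := hT.row i j₁ j₂ h1
    have := hT.lt i j₁
    simp only [extn]
    split_ifs <;> omega
  · intro i₁ i₂ j h1 h2
    have := hT.col i₁ i₂ j h1
    have := hT.lt i₁ j
    have := strips_le hl hc i₁ i₂ h1
    simp only [extn]
    split_ifs <;> omega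
  · intro v hv
    rcases Nat.lt_succ_iff_lt_or_eq.1 hv with h | rfl
    · simp only [ext_count_lt N T v h]
      exact hT.cont v h
    · simp only [ext_count v hc'.2.1 T hT.lt]
      simpa using hc'.1

lemma filter_down (m : ℕ) (p : ℕ → Prop) [DecidablePred p]
    (hp : ∀ a b, a < b → b < m → p b → p a) (j : ℕ) (hj : j < m) :
    p j ↔ j < #{j ∈ range m | p j} := by
  constructor
  · intro h
    have : range (j+1) ⊆ {j ∈ range m | p j} := by
      intro a ha
      simp only [mem_range, mem_filter] at ha ⊢
      refine ⟨by omega, ?_⟩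
      rcases Nat.lt_succ_iff_lt_or_eq.1 ha with h' | rfl
      · exact hp a j h' hj h
      · exact h
    have := Finset.card_le_card this
    simp at this
    omega
  · intro h
    by_contra hn
    have : ({j ∈ range m | p j} : Finset ℕ) ⊆ range j := by
      intro a ha
      simp only [mem_range, mem_filter] at ha ⊢
      by_contra h'
      rcases (not_lt.1 h').eq_or_lt with rfl | h''
      · exact hn ha.2
      · exact hn (hp j a h'' ha.1 ha.2)
    have := Finset.card_le_card this
    simp at this
    omega

lemma P_succ (μ : ℕ → ℕ) {n : ℕ} (N : ℕ) {l : Fin n → ℕ} (hl : Antitone l)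
    (T : Fin n → ℕ → ℕ) (hT : P μ (N+1) l T) :
    ∃ c ∈ strips l (μ N), ∃ T', P μ N (fun i => l i - c i) T' ∧ extn N l c T' = T := by
  set c : Fin n → ℕ := fun i => #{j ∈ range (l i) | T i j = N} with hcdef
  have hcl : ∀ i, #{j ∈ range (l i) | T i j < N} + c i = l i := by
    intro i
    have := Finset.card_filter_add_card_filter_not (s := range (l i)) (fun j => T i j < N)
    rw [card_range] at this
    refine Eq.trans ?_ this
    refine congrArg (#{j ∈ range (l i) | T i j < N} + ·) (congrArg Finset.card ?_)
    ext j
    simp only [mem_filter, mem_range]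
    have := hT.lt i j
    omega
  have key : ∀ i j, j < l i → (T i j < N ↔ j < l i - c i) := by
    intro i j hj
    rw [filter_down (l i) (fun j => T i j < N) (fun a b hab hb h => (hT.row i a b hab hb).trans_lt h) j hj]
    have := hcl i
    omega
  have hle : ∀ i, c i ≤ l i := fun i => by have := hcl i; omega
  have hstrip : c ∈ strips l (μ N) := by
    simp only [strips, mem_filter]
    refine ⟨?_, hle, ?_⟩
    · simp
      exact hT.cont N (by omega)
    · intro i j hij
      by_contra hcon
      have hlt : i < j := by rw [Fin.lt_def]; omega
      have h1 := hl hlt.le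
      have h2 := hle i
      have h3 := (key i (l i - c i) (by omega)).not
      have h4 := hT.col i j (l i - c i) hlt (by omega)
      have h5 := hT.lt j (l i - c i) (by omega)
      omega
  refine ⟨c, hstrip, fun i j => if j < l i - c i then T i j else 0, ?_, ?_⟩
  · constructor
    · intro i j h; exact if_neg (by omega)
    · intro i j h
      have := (key i j (by omega)).2 h
      simpa [h] using this
    · intro i j₁ j₂ h1 h2
      have h3 : j₁ < l i - c i := by omega
      simp only [if_pos h2, if_pos h3]
      exact hT.row i j₁ j₂ h1 (by omega)
    · intro i₁ i₂ j h1 h2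
      have h4 := strips_le hl hstrip i₁ i₂ h1
      have h3 : j < l i₁ - c i₁ := by omega
      simp only [if_pos h2, if_pos h3]
      exact hT.col i₁ i₂ j h1 (by omega)
    · intro v hv
      rw [← hT.cont v (by omega)]
      refine Finset.sum_congr rfl fun i _ => ?_
      congr 1
      ext j
      simp only [mem_filter, mem_range]
      constructor
      · rintro ⟨h1, h2⟩
        rw [if_pos h1] at h2
        exact ⟨by omega, h2⟩
      · rintro ⟨h1, h2⟩
        have := (key i j h1).1 (by omega)
        exact ⟨this, by rw [if_pos this]; exact h2⟩
  · funext i j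
    simp only [extn]
    split_ifs with h1 h2
    · rfl
    · have := key i j h2
      have := hT.lt i j h2
      omega
    · exact (hT.z i j (by omega)).symm

lemma mem_SST (μ : ℕ → ℕ) {n : ℕ} (N : ℕ) : ∀ (l : Fin n → ℕ) (_ : Antitone l) (T : Fin n → ℕ → ℕ),
    T ∈ SST μ N l ↔ P μ N l T := by
  classical
  induction N with
  | zero =>
    intro l hl T
    simp only [SST]
    constructor
    · intro h
      split_ifs at h with h0
      · subst h0
        simp at h
        subst h
        constructor <;> simp
      · simp at h
    · intro h
      have h0 : l = 0 := by
        funext i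
        by_contra hi
        have := h.lt i 0 (Nat.pos_of_ne_zero hi)
        omega
      rw [if_pos h0]
      simp
      funext i j
      exact h.z i j (by simp [h0])
  | succ N ih =>
    intro l hl T
    simp only [SST, mem_biUnion, mem_image]
    constructor
    · rintro ⟨c, hc, T', hT', rfl⟩
      exact P_ext μ N hl hc T' ((ih _ (strips_anti hl hc) _).1 hT')
    · intro h
      obtain ⟨c, hc, T', hT', h'⟩ := P_succ μ N hl T h
      exact ⟨c, hc, T', (ih _ (strips_anti hl hc) _).2 hT', h'⟩

lemma card_SST (μ : ℕ → ℕ) {n : ℕ} (N : ℕ) : ∀ (l : Fin n → ℕ) (_ : Antitone l),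
    D μ N (fun i => (l i : ℤ) - ((i : ℕ) : ℤ)) = #(SST μ N l) := by
  classical
  induction N with
  | zero =>
    intro l hl
    rw [D_zero]
    simp only [SST]
    split_ifs <;> simp
  | succ N ih =>
    intro l hl
    rw [D_rec μ N l hl]
    simp only [SST]
    rw [Finset.card_biUnion]
    · push_cast
      refine Finset.sum_congr rfl fun c hc => ?_
      rw [ih _ (strips_anti hl hc), Finset.card_image_of_injOn]
      intro T hT T' hT' h
      rw [mem_coe, mem_SST μ N _ (strips_anti hl hc)] at hT hT'
      funext i j
      by_cases hj : j < l i - c i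
      · have := congrFun (congrFun h i) j
        simpa [extn, hj] using this
      · rw [hT.z i j (not_lt.1 hj), hT'.z i j (not_lt.1 hj)]
    · intro c hc c' hc' hne
      refine Finset.disjoint_left.2 ?_
      intro T hT hT'
      simp only [mem_image] at hT hT'
      obtain ⟨T1, h1, e1⟩ := hT
      obtain ⟨T2, h2, e2⟩ := hT'
      rw [mem_SST μ N _ (strips_anti hl (by assumption))] at h1 h2
      apply hne
      simp only [strips, mem_coe, mem_filter] at hc hc'
      funext i
      rw [← ext_count N hc.2.1 T1 h1.lt i, ← ext_count N hc'.2.1 T2 h2.lt i, e1, e2]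

lemma kostka_eq (n N : ℕ) (lam : YoungDiagram) (mu : ℕ → ℕ)
    (hlen : ∀ i, n ≤ i → lam.rowLen i = 0) (hN : ∀ i, N ≤ i → mu i = 0) :
    kostka lam mu = #(SST mu N (fun i : Fin n => lam.rowLen i)) := by
  have hl : Antitone (fun i : Fin n => lam.rowLen i) := fun i j hij => lam.rowLen_anti _ _ hij
  have hcells : ∀ (T : ℕ → ℕ → ℕ) (v : ℕ), #{c ∈ lam.cells | T c.1 c.2 = v} =
      ∑ i : Fin n, #{j ∈ range (lam.rowLen i) | T i j = v} := by
    intro T v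
    rw [← Finset.card_sigma]
    refine Finset.card_bij' (t := univ.sigma fun i : Fin n => {j ∈ range (lam.rowLen i) | T i j = v})
      (fun c hc => (⟨⟨c.1, ?_⟩, c.2⟩ : Σ _ : Fin n, ℕ)) (fun p _ => (p.1.1, p.2)) ?_ ?_ ?_ ?_
    · simp only [mem_filter, YoungDiagram.mem_cells] at hc
      by_contra h
      have h1 := hlen c.1 (not_lt.1 h)
      have h2 := YoungDiagram.mem_iff_lt_rowLen.1 (show (c.1, c.2) ∈ lam from hc.1)
      omega
    · rintro ⟨a, b⟩ hc
      simp only [mem_filter, YoungDiagram.mem_cells, YoungDiagram.mem_iff_lt_rowLen] at hc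
      simpa using hc
    · rintro ⟨a, b⟩ hc
      simp at hc
      simpa [YoungDiagram.mem_iff_lt_rowLen] using hc
    · rintro ⟨a, b⟩ hc; rfl
    · rintro ⟨a, b⟩ hc; rfl
  unfold kostka
  rw [← Set.ncard_coe_finset]
  refine Set.ncard_congr (fun T _ => fun (i : Fin n) j => T i j) ?_ ?_ ?_
  · intro T hT
    rw [mem_coe, mem_SST _ _ _ hl]
    simp only [Set.mem_ofPred_eq, contentCount] at hT
    constructor
    · intro i j h
      exact T.zeros (by rw [YoungDiagram.mem_iff_lt_rowLen]; omega)
    · intro i j h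
      by_contra h'
      have h1 := hT (T i j)
      rw [hN _ (not_lt.1 h'), Finset.card_eq_zero, Finset.filter_eq_empty_iff] at h1
      exact h1 (x := (↑i, j)) (by
        rw [YoungDiagram.mem_cells, YoungDiagram.mem_iff_lt_rowLen]; exact h) rfl
    · intro i j₁ j₂ h1 h2
      exact T.row_weak h1 (by rw [YoungDiagram.mem_iff_lt_rowLen]; exact h2)
    · intro i₁ i₂ j h1 h2
      exact T.col_strict h1 (by rw [YoungDiagram.mem_iff_lt_rowLen]; exact h2)
    · intro v hv
      rw [← hT v, hcells]
  · intro T T' hT hT' h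
    ext i j
    by_cases hi : i < n
    · exact congrFun (congrFun h ⟨i, hi⟩) j
    · have h1 := hlen i (not_lt.1 hi)
      rw [T.zeros, T'.zeros] <;> rw [YoungDiagram.mem_iff_lt_rowLen] <;> omega
  · intro T hT
    rw [mem_coe, mem_SST _ _ _ hl] at hT
    have hn : ∀ i j, (i, j) ∈ lam → ∃ h : i < n, j < lam.rowLen i := by
      intro i j hij
      rw [YoungDiagram.mem_iff_lt_rowLen] at hij
      refine ⟨?_, hij⟩
      by_contra h
      have := hlen i (not_lt.1 h)
      omega
    let T0 : SemistandardYoungTableau lam :=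
      { entry := fun i j => if h : i < n then T ⟨i, h⟩ j else 0
        row_weak' := by
          intro i j1 j2 h1 h2
          obtain ⟨h, h3⟩ := hn _ _ h2
          simp only [dif_pos h]
          exact hT.row _ _ _ h1 h3
        col_strict' := by
          intro i1 i2 j h1 h2
          obtain ⟨h, h3⟩ := hn _ _ h2
          simp only [dif_pos h, dif_pos (h1.trans h)]
          exact hT.col _ _ _ h1 h3
        zeros' := by
          intro i j h
          rw [YoungDiagram.mem_iff_lt_rowLen] at h
          split_ifs with h1
          · exact hT.z _ _ (not_lt.1 h)
          · rfl }
    have hT0 : ∀ (i : Fin n) j, T0 i j = T i j := by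
      intro i j
      show (if h : (i : ℕ) < n then T ⟨i, h⟩ j else 0) = T i j
      rw [dif_pos i.2]
    refine ⟨T0, ?_, ?_⟩
    · intro v
      unfold contentCount
      rw [hcells (fun i j => T0 i j) v]
      simp only [hT0]
      by_cases hv : v < N
      · exact hT.cont v hv
      · rw [hN v (not_lt.1 hv)]
        apply Finset.sum_eq_zero
        intro i _
        rw [Finset.card_eq_zero, Finset.filter_eq_empty_iff]
        intro j hj
        have := hT.lt i j (mem_range.1 hj)
        omega
    · funext i j
      exact hT0 i j

lemma permChar_eq (d n : ℕ) (α : Fin n → ℤ) (g : Equiv.Perm (Fin d)) :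
    permChar d (fun k => if h : k < n then α ⟨k, h⟩ else 0) g =
      #{f : Fin d → Fin n | (∀ x, f (g x) = f x) ∧ ∀ i, (#{x | f x = i} : ℤ) = α i} := by
  unfold permChar
  split_ifs with h0
  · norm_cast
    rw [← Set.ncard_coe_finset]
    symm
    refine Set.ncard_congr (fun f _ x => (f x : ℕ)) ?_ ?_ ?_
    · intro f hf
      simp only [coe_filter, mem_univ, true_and, Set.mem_ofPred_eq] at hf ⊢
      refine ⟨fun i => by rw [hf.1], fun k => ?_⟩
      split_ifs with hk
      · rw [← hf.2]
        congr 2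
        ext x
        simp [Fin.ext_iff]
      · rw [Nat.cast_eq_zero, Finset.card_eq_zero, Finset.filter_eq_empty_iff]
        intro x _ h
        have := (f x).2
        omega
    · intro f f' _ _ h
      funext x
      exact Fin.ext (congrFun h x)
    · intro f hf
      simp only [Set.mem_ofPred_eq] at hf
      have hlt : ∀ x, f x < n := by
        intro x
        by_contra h
        have := hf.2 (f x)
        rw [dif_neg h, Nat.cast_eq_zero, Finset.card_eq_zero, Finset.filter_eq_empty_iff] at this
        exact this (mem_univ x) rfl
      refine ⟨fun x => ⟨f x, hlt x⟩, ?_, rfl⟩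
      simp only [coe_filter, mem_univ, true_and, Set.mem_ofPred_eq]
      refine ⟨fun x => Fin.ext (hf.1 x), fun i => ?_⟩
      have := hf.2 i
      rw [dif_pos i.2] at this
      rw [← this]
      congr 2
      ext x
      simp [Fin.ext_iff]
  · symm
    rw [Nat.cast_eq_zero, Finset.card_eq_zero, Finset.filter_eq_empty_iff]
    rintro f _ ⟨_, h2⟩
    apply h0
    intro k
    beta_reduce
    split_ifs with hk
    · rw [← h2]; positivity
    · rfl

lemma youngBlock_iff (d N : ℕ) (mu : ℕ → ℕ) (ha : Antitone mu) (hN : ∀ i, N ≤ i → mu i = 0)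
    (hs : ∑ i ∈ range N, mu i = d) (x : ℕ) (hx : x < d) (k : ℕ) :
    youngBlock mu x = k ↔ ∑ j ∈ range k, mu j ≤ x ∧ x < ∑ j ∈ range (k+1), mu j := by
  have mono : Monotone fun k => ∑ j ∈ range k, mu j := by
    intro a b hab
    exact Finset.sum_le_sum_of_subset (range_mono hab)
  have hbig : ∀ k, mu k = 0 → x < ∑ j ∈ range k, mu j := by
    intro k hk
    rcases le_total N k with h | h
    · have := mono h
      simp only [hs] at this
      omega
    · rw [← Finset.sum_range_add_sum_Ico _ h] at hs
      rw [Finset.sum_eq_zero (s := Ico k N)] at hs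
      · omega
      · intro i hi
        have := ha (mem_Ico.1 hi).1
        omega
  have hlow : ∀ k, ∑ j ∈ range (k+1), mu j ≤ x → k < x + 1 := by
    intro k hk
    have hpos : ∀ j ∈ range (k+1), 1 ≤ mu j := by
      intro j hj
      by_contra h
      have h0 : mu (k+1) = 0 := by
        have := ha (show j ≤ k+1 by have := mem_range.1 hj; omega)
        omega
      have := hbig _ h0
      omega
    have := Finset.card_nsmul_le_sum (range (k+1)) mu 1 hpos
    simp only [card_range, smul_eq_mul, mul_one] at this
    have h3 : (range (k+1)).sum mu = ∑ j ∈ range (k+1), mu j := rfl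
    exact Nat.lt_succ_of_le (by omega)
  have hd : ∀ a b, a < b → b < x + 1 → ∑ j ∈ range (b+1), mu j ≤ x → ∑ j ∈ range (a+1), mu j ≤ x :=
    fun a b hab _ h => (mono (show a + 1 ≤ b + 1 by omega)).trans h
  have hlt : ∀ k, ∑ j ∈ range (k+1), mu j ≤ x ↔ k < youngBlock mu x := by
    intro k
    by_cases hk : k < x + 1
    · exact filter_down (x+1) (fun k => ∑ j ∈ range (k+1), mu j ≤ x) hd k hk
    · constructor
      · intro h; exact absurd (hlow k h) hk
      · intro h
        have : youngBlock mu x ≤ x + 1 := by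
          unfold youngBlock
          refine (Finset.card_filter_le _ _).trans ?_
          simp
        omega
  have hx1 : ∑ j ∈ range k, mu j ≤ x ↔ k ≤ youngBlock mu x := by
    cases k with
    | zero => simp
    | succ k => rw [hlt]; omega
  rw [hx1, ← not_le, hlt]
  omega

lemma main (d n N : ℕ) (lam : YoungDiagram) (mu : ℕ → ℕ)
    (hlen : ∀ i, n ≤ i → lam.rowLen i = 0) (ha : Antitone mu) (hN : ∀ i, N ≤ i → mu i = 0)
    (hs : ∑ i ∈ range N, mu i = d) :
    ∑ g ∈ youngMembers d mu, irredChar d n (fun i : Fin n => lam.rowLen i) g =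
      ((youngMembers d mu).card : ℤ) * (kostka lam mu : ℤ) := by
  have hyb := youngBlock_iff d N mu ha hN hs
  have mono : Monotone fun k => ∑ j ∈ range k, mu j := by
    intro a b hab
    exact Finset.sum_le_sum_of_subset (range_mono hab)
  have hlt : ∀ x : Fin d, youngBlock mu x < N := by
    intro x
    by_contra h
    have h1 := ((hyb x x.2 _).1 rfl).1
    have h2 := mono (not_lt.1 h)
    simp only [hs] at h2
    have := x.2
    omega
  let blk : Fin d → Fin N := fun x => ⟨youngBlock mu x, hlt x⟩
  have hY : youngMembers d mu = Y blk := by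
    ext g
    simp [youngMembers, mem_Y, blk]
  have hblk : ∀ k : Fin N, #{x | blk x = k} = mu k := by
    intro k
    have h1 : #{x | blk x = k} = #(Ico (∑ j ∈ range k, mu j) (∑ j ∈ range (k+1), mu j)) := by
      refine Finset.card_bij (fun x _ => (x : ℕ)) ?_ ?_ ?_
      · intro x hx
        simp only [mem_filter, mem_univ, true_and, blk, Fin.ext_iff] at hx
        rw [mem_Ico]
        exact (hyb x x.2 k).1 hx
      · intro x _ y _ h; exact Fin.ext h
      · intro y hy
        rw [mem_Ico] at hy
        have h2 := mono (show (k : ℕ) + 1 ≤ N from k.2)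
        simp only [hs] at h2
        have hyd : y < d := by omega
        refine ⟨⟨y, hyd⟩, ?_, rfl⟩
        simp only [mem_filter, mem_univ, true_and, blk, Fin.ext_iff]
        exact (hyb y hyd k).2 hy
    rw [h1, Nat.card_Ico, Finset.sum_range_succ]
    omega
  have hl : Antitone (fun i : Fin n => lam.rowLen i) := fun i j hij => lam.rowLen_anti _ _ hij
  rw [kostka_eq n N lam mu hlen hN, ← card_SST mu N _ hl, hY]
  unfold irredChar D
  rw [Finset.sum_comm, Finset.mul_sum]
  refine Finset.sum_congr rfl fun w _ => ?_
  rw [← Finset.mul_sum]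
  have e : ∀ g, permChar d (fun k => if h : k < n then
          (lam.rowLen (⟨k, h⟩ : Fin n) : ℤ) + ((w ⟨k, h⟩ : ℕ) : ℤ) - (k : ℤ)
        else 0) g = _ := fun g => permChar_eq d n
          (fun i : Fin n => (lam.rowLen i : ℤ) + ((w i : ℕ) : ℤ) - ((i : ℕ) : ℤ)) g
  rw [Finset.sum_congr rfl fun g _ => e g]
  have hb := burnside blk (fun k => mu k) hblk
    (fun i : Fin n => (lam.rowLen i : ℤ) + ((w i : ℕ) : ℤ) - ((i : ℕ) : ℤ))
  replace hb := congrArg (Nat.cast : ℕ → ℤ) hb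
  rw [Nat.cast_sum, Nat.cast_mul] at hb
  refine Eq.trans (congrArg (_ * ·) (Eq.trans (Finset.sum_congr rfl fun g _ => ?_) hb)) ?_
  · congr!
  have : (fun i : Fin n => (lam.rowLen i : ℤ) + ((w i : ℕ) : ℤ) - ((i : ℕ) : ℤ)) =
    fun i : Fin n => (lam.rowLen i : ℤ) - ((i : ℕ) : ℤ) + ((w i : ℕ) : ℤ) := by
    funext i; ring
  rw [this]
  unfold M
  ring

end KP

/-- the multiplicity of the trivial representation of the Young subgroup
`S_mu` in the restriction of the irreducible representation of `S_d` indexed by `lam`,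
namely `(1/|S_mu|) ∑_{g ∈ S_mu} χ^lam(g)`, equals the Kostka number `K_{lam,mu}`. -/
theorem stmt6 (d n : ℕ) (lam : YoungDiagram) (mu : ℕ → ℕ) (hd : lam.card = d)
    (hlen : ∀ i, n ≤ i → lam.rowLen i = 0) (hmu : IsPartitionOf d mu) :
    ∑ g ∈ youngMembers d mu, irredChar d n (fun i : Fin n => lam.rowLen i) g =
      ((youngMembers d mu).card : ℤ) * (kostka lam mu : ℤ) := by
  obtain ⟨ha, N, hN, hs⟩ := hmu
  exact KP.main d n N lam mu hlen ha hN hs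
end

section
/- Let γ = (γ_1, ..., γ_n) be a composition of N with nonnegative parts, let θ be a partition of N, and let α and β be compositions of n such that β is a refinement of α. If the Kostka number K_{θ, sort(γ|_α)} is nonzero, then K_{θ, sort(γ|_β)} is nonzero, where γ|_α denotes the meld of γ along α (summing γ over consecutive blocks of sizes α_1, α_2, ...). -/
open Finset

/-- `α` is a composition of `n` with `ℓ` parts: positive parts `α 0, …, α (ℓ-1)` summing
to `n` (and `0` beyond). -/
def IsComposition (α : ℕ → ℕ) (ℓ n : ℕ) : Prop :=
  (∀ i < ℓ, 0 < α i) ∧ (∀ i, ℓ ≤ i → α i = 0) ∧ ∑ i ∈ Finset.range ℓ, α i = n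

/-- The meld `γ|_α`: its `k`-th part is the sum of `γ` over the `k`-th consecutive block
of size `α k`. -/
def meld (γ α : ℕ → ℕ) (k : ℕ) : ℕ :=
  ∑ i ∈ Finset.Ico (∑ j ∈ Finset.range k, α j) (∑ j ∈ Finset.range (k + 1), α j), γ i

/-- `β` (with `ℓβ` parts) is a refinement of `α` (with `ℓα` parts): each part of `α` is
the sum of a consecutive run of parts of `β`. -/
def Refines (β : ℕ → ℕ) (ℓβ : ℕ) (α : ℕ → ℕ) (ℓα : ℕ) : Prop :=
  ∃ t : ℕ → ℕ, Monotone t ∧ t 0 = 0 ∧ (∀ k, ℓα ≤ k → t k = ℓβ) ∧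
    ∀ k, α k = ∑ j ∈ Finset.Ico (t k) (t (k + 1)), β j

namespace StmtAux

lemma sum_meld (γ α : ℕ → ℕ) (k : ℕ) :
    ∑ j ∈ range k, meld γ α j = ∑ i ∈ range (∑ j ∈ range k, α j), γ i := by
  induction k with
  | zero => simp
  | succ k ih =>
    rw [sum_range_succ, ih, meld, Finset.sum_range_add_sum_Ico]
    exact Finset.sum_le_sum_of_subset (Finset.range_mono (Nat.le_succ k))

lemma sum_ref (α β t : ℕ → ℕ) (ht : Monotone t) (h0 : t 0 = 0)
    (h : ∀ k, α k = ∑ j ∈ Finset.Ico (t k) (t (k + 1)), β j) (k : ℕ) :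
    ∑ j ∈ range k, α j = ∑ j ∈ range (t k), β j := by
  induction k with
  | zero => simp [h0]
  | succ k ih =>
    rw [sum_range_succ, ih, h, Finset.sum_range_add_sum_Ico]
    exact ht (Nat.le_succ k)

/-- sort key -/
def key {μ : YoungDiagram} (T : SemistandardYoungTableau μ) (c : ℕ × ℕ) : ℕ ×ₗ ℕ :=
  toLex (T c.1 c.2, c.2)

/-- rank of a cell -/
def rk {μ : YoungDiagram} (T : SemistandardYoungTableau μ) (c : ℕ × ℕ) : ℕ :=
  (μ.cells.filter fun c' => key T c' < key T c).card

variable {μ : YoungDiagram} (T : SemistandardYoungTableau μ)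

lemma key_inj {c d : ℕ × ℕ} (hc : c ∈ μ) (hd : d ∈ μ) (h : key T c = key T d) : c = d := by
  obtain ⟨i, j⟩ := c
  obtain ⟨i', j'⟩ := d
  have h' := toLex_inj.mp h
  simp only [Prod.mk.injEq] at h'
  obtain ⟨h1, rfl⟩ := h'
  rcases lt_trichotomy i i' with hl | rfl | hl
  · have := T.col_strict hl hd; omega
  · rfl
  · have := T.col_strict hl hc; omega

lemma rk_mono {c d : ℕ × ℕ} (h : key T c ≤ key T d) : rk T c ≤ rk T d := by
  apply card_le_card
  intro x hx
  simp only [mem_filter] at hx ⊢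
  exact ⟨hx.1, hx.2.trans_le h⟩

lemma rk_strict {c d : ℕ × ℕ} (hc : c ∈ μ) (h : key T c < key T d) : rk T c < rk T d := by
  apply card_lt_card
  rw [Finset.ssubset_iff_of_subset]
  · exact ⟨c, by simp [hc, h], by simp⟩
  · intro x hx
    simp only [mem_filter] at hx ⊢
    exact ⟨hx.1, hx.2.trans h⟩

lemma rk_lt {c : ℕ × ℕ} (hc : c ∈ μ) : rk T c < μ.card := by
  apply card_lt_card
  rw [Finset.ssubset_iff_of_subset (filter_subset _ _)]
  exact ⟨c, by simpa using hc, by simp⟩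

lemma rk_inj : Set.InjOn (rk T) μ.cells := by
  intro c hc d hd h
  have hc : c ∈ μ := by simpa using hc
  have hd : d ∈ μ := by simpa using hd
  rcases lt_trichotomy (key T c) (key T d) with hl | he | hl
  · have := rk_strict T hc hl; omega
  · exact key_inj T hc hd he
  · have := rk_strict T hd hl; omega

lemma rk_image : μ.cells.image (rk T) = range μ.card := by
  apply eq_of_subset_of_card_le
  · intro x hx
    obtain ⟨c, hc, rfl⟩ := mem_image.mp hx
    exact mem_range.mpr (rk_lt T (by simpa using hc))
  · rw [card_image_of_injOn (rk_inj T)]; simp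

lemma card_rk (p : ℕ → Prop) [DecidablePred p] :
    (μ.cells.filter fun c => p (rk T c)).card = ((range μ.card).filter p).card := by
  rw [← rk_image T, filter_image, card_image_of_injOn]
  exact (rk_inj T).mono (by exact_mod_cast filter_subset _ _)

lemma card_lt (k : ℕ) : (μ.cells.filter fun c => T c.1 c.2 < k).card
    = ∑ v ∈ range k, contentCount T v := by
  rw [card_eq_sum_card_fiberwise (f := fun c => T c.1 c.2) (t := range k)]
  · apply sum_congr rfl
    intro v hv
    rw [contentCount, filter_filter]
    congr 1
    apply filter_congr
    intro c _
    have := mem_range.mp hv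
    constructor
    · exact fun h => h.2
    · intro h; exact ⟨by omega, h⟩
  · intro c hc
    simpa using (mem_filter.mp (mem_coe.mp hc)).2

lemma le_rk (c : ℕ × ℕ) : ∑ v ∈ range (T c.1 c.2), contentCount T v ≤ rk T c := by
  rw [← card_lt]
  apply card_le_card
  intro x hx
  simp only [mem_filter] at hx ⊢
  exact ⟨hx.1, Prod.Lex.toLex_lt_toLex.mpr (Or.inl hx.2)⟩

lemma rk_lt_of {c : ℕ × ℕ} (hc : c ∈ μ) {k : ℕ} (h : T c.1 c.2 < k) :
    rk T c < ∑ v ∈ range k, contentCount T v := by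
  rw [← card_lt]
  apply card_lt_card
  rw [Finset.ssubset_iff_of_subset]
  · exact ⟨c, by simp [hc, h], by simp⟩
  · intro x hx
    simp only [mem_filter] at hx ⊢
    refine ⟨hx.1, ?_⟩
    rcases Prod.Lex.toLex_lt_toLex.mp hx.2 with h' | h'
    · exact lt_trans h' h
    · have := h'.1
      simp only at this
      omega

/-- label -/
noncomputable def lab (b : ℕ → ℕ) (r : ℕ) : ℕ := sInf {v | r < ∑ j ∈ range (v + 1), b j}

lemma S_mono (b : ℕ → ℕ) {v w : ℕ} (h : v ≤ w) : ∑ j ∈ range v, b j ≤ ∑ j ∈ range w, b j :=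
  Finset.sum_le_sum_of_subset (Finset.range_mono h)

lemma lab_lt (b : ℕ → ℕ) {r M : ℕ} (hM : r < ∑ j ∈ range M, b j) (v : ℕ) :
    lab b r < v ↔ r < ∑ j ∈ range v, b j := by
  have hne : {v | r < ∑ j ∈ range (v + 1), b j}.Nonempty :=
    ⟨M, hM.trans_le (S_mono b (Nat.le_succ M))⟩
  constructor
  · intro h
    have h1 : r < ∑ j ∈ range (lab b r + 1), b j := Nat.sInf_mem hne
    exact h1.trans_le (S_mono b h)
  · intro h
    cases v with
    | zero => simp at h
    | succ w => exact Nat.lt_succ_of_le (Nat.sInf_le h)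

lemma exists_ref (b t : ℕ → ℕ) (M : ℕ) (hM : ∑ j ∈ range M, b j = μ.card)
    (hb0 : ∀ v, M ≤ v → b v = 0)
    (ht : ∀ k, ∑ v ∈ range k, contentCount T v = ∑ v ∈ range (t k), b v) :
    ∃ T' : SemistandardYoungTableau μ, ∀ v, contentCount T' v = b v := by
  have hlt : ∀ {c : ℕ × ℕ}, c ∈ μ → rk T c < ∑ j ∈ range M, b j := by
    intro c hc; rw [hM]; exact rk_lt T hc
  classical
  refine ⟨⟨fun i j => if (i, j) ∈ μ then lab b (rk T (i, j)) else 0, ?_, ?_, ?_⟩, ?_⟩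
  · intro i j1 j2 hj h2
    have h1 : (i, j1) ∈ μ := μ.up_left_mem le_rfl hj.le h2
    rw [if_pos h1, if_pos h2, ← Nat.lt_succ_iff, lab_lt b (hlt h1)]
    have hk : rk T (i, j1) ≤ rk T (i, j2) := by
      apply rk_mono
      apply Prod.Lex.toLex_le_toLex.mpr
      have := T.row_weak hj h2
      simp only
      omega
    exact hk.trans_lt ((lab_lt b (hlt h2) _).mp (Nat.lt_succ_self _))
  · intro i1 i2 j hi h2
    have h1 : (i1, j) ∈ μ := μ.up_left_mem hi.le le_rfl h2
    rw [if_pos h1, if_pos h2]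
    have ha := rk_lt_of T h1 (T.col_strict hi h2)
    have hb := le_rk T (i2, j)
    simp only at hb
    rw [ht] at ha hb
    rw [← lab_lt b (hlt h1)] at ha
    have hb' := (lab_lt b (hlt h2) _).not.mpr (not_lt.mpr hb)
    exact ha.trans_le (not_lt.mp hb')
  · intro i j h
    simp [h]
  · intro v
    have e : ∀ c ∈ μ.cells, ((if (c.1, c.2) ∈ μ then lab b (rk T (c.1, c.2)) else 0) = v ↔
        (∑ j ∈ range v, b j ≤ rk T c ∧ rk T c < ∑ j ∈ range (v+1), b j)) := by
      intro c hc
      have hc : c ∈ μ := by simpa using hc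
      rw [if_pos hc, ← lab_lt b (hlt hc), ← not_lt, ← lab_lt b (hlt hc)]
      simp only [Prod.mk.eta]
      omega
    change (μ.cells.filter fun c => (if (c.1, c.2) ∈ μ then lab b (rk T (c.1, c.2)) else 0) = v).card = _
    rw [filter_congr e, card_rk T (fun r => ∑ j ∈ range v, b j ≤ r ∧ r < ∑ j ∈ range (v+1), b j)]
    by_cases hv : v < M
    · have h1 : ∑ j ∈ range (v+1), b j ≤ μ.card := hM ▸ S_mono b hv
      have : (range μ.card).filter (fun r => ∑ j ∈ range v, b j ≤ r ∧ r < ∑ j ∈ range (v+1), b j)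
          = Ico (∑ j ∈ range v, b j) (∑ j ∈ range (v+1), b j) := by
        ext r; simp only [mem_filter, mem_range, mem_Ico]; omega
      rw [this, Nat.card_Ico, sum_range_succ]; omega
    · have h0 := hb0 v (not_lt.mp hv)
      rw [h0, card_eq_zero, filter_eq_empty_iff]
      intro r _
      rw [sum_range_succ, h0]
      omega

lemma finite_set (b : ℕ → ℕ) (M : ℕ) (hb : ∀ v, M ≤ v → b v = 0) :
    {T : SemistandardYoungTableau μ | ∀ v : ℕ, contentCount T v = b v}.Finite := by
  have hf : (Set.pi Set.univ (fun _ : μ.cells => Set.Iio M)).Finite :=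
    Set.Finite.pi fun _ => Set.finite_Iio M
  refine Set.Finite.of_injOn (f := fun T (c : μ.cells) => T c.1.1 c.1.2) ?_ ?_ hf
  · intro T hT c _
    by_contra h
    have h0 := hT (T c.1.1 c.1.2)
    rw [hb _ (by simpa using h), contentCount, card_eq_zero] at h0
    have : c.1 ∈ (∅ : Finset (ℕ × ℕ)) := h0 ▸ mem_filter.mpr ⟨c.2, rfl⟩
    simp at this
  · intro T _ T' _ h
    ext i j
    by_cases hc : (i, j) ∈ μ
    · exact congrFun h ⟨(i, j), by simpa using hc⟩
    · rw [T.zeros hc, T'.zeros hc]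

end StmtAux

/-- if `β` refines `α` and `K_{θ, γ|_α} ≠ 0`, then `K_{θ, γ|_β} ≠ 0`
(Kostka numbers for composition contents; `K_{θ,c}` depends only on the sorted
rearrangement of `c`). -/
theorem stmt8 (N n ℓα ℓβ : ℕ) (θ : YoungDiagram) (hθ : θ.card = N)
    (γ : ℕ → ℕ) (hγ0 : ∀ i, n ≤ i → γ i = 0) (hγsum : ∑ i ∈ Finset.range n, γ i = N)
    (α β : ℕ → ℕ) (hα : IsComposition α ℓα n) (hβ : IsComposition β ℓβ n)
    (href : Refines β ℓβ α ℓα)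
    (hK : kostka θ (meld γ α) ≠ 0) : kostka θ (meld γ β) ≠ 0 := by
  obtain ⟨t, ht, h0, -, hr⟩ := href
  obtain ⟨T, hT⟩ := Set.nonempty_of_ncard_ne_zero hK
  have hz : ∀ v, ℓβ ≤ v → meld γ β v = 0 := by
    intro v hv
    rw [meld, sum_range_succ, hβ.2.1 v hv]; simp
  have hM : ∑ j ∈ range ℓβ, meld γ β j = θ.card := by
    rw [StmtAux.sum_meld, hβ.2.2, hγsum, hθ]
  obtain ⟨T', hT'⟩ := StmtAux.exists_ref T (meld γ β) t ℓβ hM hz (by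
    intro k
    rw [sum_congr rfl (fun v _ => hT v), StmtAux.sum_meld, StmtAux.sum_meld,
      StmtAux.sum_ref α β t ht h0 hr])
  exact Set.ncard_ne_zero_of_mem (a := T') hT' (StmtAux.finite_set _ ℓβ hz)
end
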